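/- Let Ω ⊆ ℝⁿ be an open set, let η : Ω → [0,∞) be continuous, and let u be a convex function on Ω whose Monge–Ampère measure satisfies Mu(E) ≥ ∫_E η(x) dx for every Borel set E ⊆ Ω. Then the (n−1)-dimensional Hausdorff measure of Σ_u ∖ L_η is zero, i.e., H^{n−1}(Σ_u ∖ L_η) = 0. -/

import Mathlib

open MeasureTheory Set
open scoped RealInnerProductSpace ENNReal

noncomputable section

abbrev En (n : ℕ) := EuclideanSpace ℝ (Fin n)

/-- The subgradient of `u` (as a convex function on `Ω`) at `x`. -/
def subgrad {n : ℕ} (Ω : Set (En n)) (u : En n → ℝ) (x : En n) : Set (En n) :=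
  {p | ∀ y ∈ Ω, u x + ⟪p, y - x⟫ ≤ u y}

/-- The Monge–Ampère measure of `u` on a set `s`. -/
def MAm {n : ℕ} (Ω : Set (En n)) (u : En n → ℝ) (s : Set (En n)) : ℝ≥0∞ :=
  volume (⋃ x ∈ s, subgrad Ω u x)

/-- `x₀` is a strictly convex point of `u` on `Ω`. -/
def IsStrictConvexPt {n : ℕ} (Ω : Set (En n)) (u : En n → ℝ) (x₀ : En n) : Prop :=
  ∀ x ∈ Ω, x ≠ x₀ → u ((1/2 : ℝ) • (x + x₀)) < (u x + u x₀) / 2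

/-- `Σ_u`: the set of non-strictly convex points of `u` in `Ω`. -/
def SigmaSet {n : ℕ} (Ω : Set (En n)) (u : En n → ℝ) : Set (En n) :=
  {x ∈ Ω | ¬ IsStrictConvexPt Ω u x}

/-- `L_η`: the union of all non-degenerate line segments contained in the zero set
`Z_η = {x ∈ Ω : η x = 0}`. -/
def Lset {n : ℕ} (Ω : Set (En n)) (η : En n → ℝ) : Set (En n) :=
  {x | ∃ a b : En n, a ≠ b ∧ segment ℝ a b ⊆ {y ∈ Ω | η y = 0} ∧ x ∈ segment ℝ a b}

section ConvexBasics

variable {n : ℕ} {Ω : Set (En n)} {u : En n → ℝ}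

/-- A lower bound by an affine function up to a quadratic error near a point is a global affine
lower bound for a convex function. -/
lemma affine_le_of_quadratic {C : Set (En n)} {φ : En n → ℝ} (hφ : ConvexOn ℝ C φ) {y₀ g : En n}
    (hy₀ : y₀ ∈ C) {ρ : ℝ} (hρ : 0 < ρ)
    (h : ∀ y ∈ C, ‖y - y₀‖ ≤ ρ → φ y₀ + ⟪g, y - y₀⟫ - ‖y - y₀‖ ^ 2 / 2 ≤ φ y) :
    ∀ y ∈ C, φ y₀ + ⟪g, y - y₀⟫ ≤ φ y := by
  intro y hy
  set d := y - y₀ with hd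
  have key : ∀ t : ℝ, 0 < t → t ≤ 1 → t * ‖d‖ ≤ ρ →
      φ y₀ + ⟪g, d⟫ - t * ‖d‖ ^ 2 / 2 ≤ φ y := by
    intro t ht ht1 htρ
    have hmem : (1 - t) • y₀ + t • y ∈ C := hφ.1 hy₀ hy (by linarith) ht.le (by ring)
    have hsub : (1 - t) • y₀ + t • y - y₀ = t • d := by rw [hd]; module
    have h1 := h _ hmem (by rw [hsub, norm_smul, Real.norm_of_nonneg ht.le]; exact htρ)
    have h2 := hφ.2 hy₀ hy (by linarith : 0 ≤ 1 - t) ht.le (by ring)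
    rw [hsub, inner_smul_right, norm_smul, Real.norm_of_nonneg ht.le] at h1
    simp only [smul_eq_mul] at h2
    have : t * (φ y₀ + ⟪g, d⟫ - t * ‖d‖ ^ 2 / 2) ≤ t * φ y := by nlinarith
    exact le_of_mul_le_mul_left this ht
  refine le_of_forall_pos_le_add fun ε hε => ?_
  have hn := norm_nonneg d
  set t := min 1 (min (ρ / (‖d‖ + 1)) (ε / (‖d‖ ^ 2 + 1))) with ht
  have hD : 0 < ‖d‖ ^ 2 + 1 := by positivity
  have htpos : 0 < t := by
    simp only [ht, lt_min_iff]
    exact ⟨one_pos, by positivity, by positivity⟩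
  have ht2 : t ≤ ρ / (‖d‖ + 1) := (min_le_right _ _).trans (min_le_left _ _)
  have ht3 : t ≤ ε / (‖d‖ ^ 2 + 1) := (min_le_right _ _).trans (min_le_right _ _)
  rw [le_div_iff₀ (by positivity)] at ht2 ht3
  have := key t htpos (min_le_left _ _) (by nlinarith)
  nlinarith

/-- A supporting linear form on a subspace extends to a subgradient (Hahn–Banach). -/
lemma exists_subgrad_extending (hΩ : IsOpen Ω) (hu : ConvexOn ℝ Ω u) {x g : En n} (hx : x ∈ Ω)
    (Q : Submodule ℝ (En n)) (hg : ∀ y ∈ Q, x + y ∈ Ω → u x + ⟪g, y⟫ ≤ u (x + y)) :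
    ∃ p ∈ subgrad Ω u x, ∀ y ∈ Q, ⟪p, y⟫ = ⟪g, y⟫ := by
  have hc : ContinuousOn u Ω := hu.continuousOn hΩ
  let s : Set (En n × ℝ) := {z | z.1 ∈ Ω ∧ u z.1 < z.2}
  let t : Set (En n × ℝ) := {z | ∃ y ∈ Q, z = (x + y, u x + ⟪g, y⟫)}
  have hs : Convex ℝ s := hu.convex_strict_epigraph
  have hso : IsOpen s := by
    have h1 : IsOpen (Ω ×ˢ (univ : Set ℝ)) := hΩ.prod isOpen_univ
    have h2 : ContinuousOn (fun z : En n × ℝ => z.2 - u z.1) (Ω ×ˢ (univ : Set ℝ)) :=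
      continuousOn_snd.sub (hc.comp continuousOn_fst fun z hz => hz.1)
    have h3 := h2.isOpen_inter_preimage h1 (isOpen_Ioi (a := (0 : ℝ)))
    convert h3 using 1
    ext z
    simp [s]
  have ht : Convex ℝ t := by
    rintro _ ⟨y, hy, rfl⟩ _ ⟨y', hy', rfl⟩ a b ha hb hab
    refine ⟨a • y + b • y', Q.add_mem (Q.smul_mem _ hy) (Q.smul_mem _ hy'), ?_⟩
    have hb' : b = 1 - a := by linarith
    subst hb'
    ext1
    · simp only [Prod.smul_mk, Prod.mk_add_mk]
      module
    · simp only [Prod.smul_mk, Prod.mk_add_mk, smul_eq_mul, inner_add_right, inner_smul_right]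
      ring
  have hdisj : Disjoint s t := by
    rw [Set.disjoint_left]
    rintro _ ⟨h1, h2⟩ ⟨y, hy, rfl⟩
    exact absurd (hg y hy h1) (not_le.mpr h2)
  obtain ⟨f, c, hf1, hf2⟩ := geometric_hahn_banach_open hs hso ht hdisj
  set α : En n →L[ℝ] ℝ := f.comp (ContinuousLinearMap.inl ℝ (En n) ℝ) with hα
  set β : ℝ := f (0, 1) with hβ
  have hf : ∀ y r, f (y, r) = α y + r * β := by
    intro y r
    have : ((y, r) : En n × ℝ) = (y, 0) + r • ((0 : En n), (1 : ℝ)) := by ext1 <;> simp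
    rw [this, map_add, map_smul]
    simp [hα, hβ]
  have hx0 : c ≤ α x + u x * β := by
    have := hf2 (x, u x) ⟨0, Q.zero_mem, by simp⟩
    rwa [hf] at this
  have hβneg : β < 0 := by
    have h1 := hf1 (x, u x + 1) ⟨hx, by simp⟩
    rw [hf] at h1
    nlinarith
  have hle : ∀ y ∈ Ω, α y + u y * β ≤ c := by
    intro y hy
    refine le_of_forall_pos_le_add fun ε hε => ?_
    have h1 := hf1 (y, u y + ε / (-β)) ⟨hy, by
      have : 0 < ε / (-β) := div_pos hε (by linarith)
      simpa using this⟩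
    rw [hf] at h1
    have hb0 : β ≠ 0 := hβneg.ne
    have h2 : ε / (-β) * β = -ε := by field_simp
    nlinarith
  have hQ : ∀ y ∈ Q, α y + ⟪g, y⟫ * β = 0 := by
    intro y hy
    by_contra hne
    have hcx : α x + u x * β ≤ c := hle x hx
    have h1 : ∀ τ : ℝ, 0 ≤ τ * (α y + ⟪g, y⟫ * β) := by
      intro τ
      have h2 := hf2 (x + τ • y, u x + ⟪g, τ • y⟫) ⟨τ • y, Q.smul_mem _ hy, rfl⟩
      rw [hf, map_add, map_smul, inner_smul_right, smul_eq_mul] at h2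
      linarith
    have h3 := h1 (-(α y + ⟪g, y⟫ * β))
    have h4 : 0 < (α y + ⟪g, y⟫ * β) ^ 2 := by positivity
    nlinarith
  let q : En n := (InnerProductSpace.toDual ℝ (En n)).symm α
  have hq : ∀ y, ⟪q, y⟫ = α y := fun y => InnerProductSpace.toDual_symm_apply
  refine ⟨(-β)⁻¹ • q, ?_, ?_⟩
  · intro y hy
    have h1 := hle y hy
    rw [inner_smul_left, hq, map_sub]
    simp only [conj_trivial]
    have hb : 0 < -β := by linarith
    have h2 : (-β)⁻¹ * (α y - α x) ≤ u y - u x := by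
      rw [inv_mul_le_iff₀ hb]
      nlinarith
    linarith
  · intro y hy
    rw [inner_smul_left, hq]
    simp only [conj_trivial]
    have h1 := hQ y hy
    have hb : -β ≠ 0 := by linarith
    rw [inv_mul_eq_iff_eq_mul₀ hb]
    linarith

lemma subgrad_nonempty (hΩ : IsOpen Ω) (hu : ConvexOn ℝ Ω u) {x : En n} (hx : x ∈ Ω) :
    (subgrad Ω u x).Nonempty := by
  obtain ⟨p, hp, -⟩ := exists_subgrad_extending (g := 0) hΩ hu hx ⊥ (by
    intro y hy _
    rw [Submodule.mem_bot] at hy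
    simp [hy])
  exact ⟨p, hp⟩

lemma exists_subgrad_norm_le (hΩ : IsOpen Ω) (hu : ConvexOn ℝ Ω u) {K : Set (En n)}
    (hK : IsCompact K) (hKΩ : K ⊆ Ω) : ∃ M, ∀ y ∈ K, ∀ p ∈ subgrad Ω u y, ‖p‖ ≤ M := by
  obtain ⟨δ, hδ, hsub⟩ := hK.exists_cthickening_subset_open hΩ hKΩ
  have hcomp : IsCompact (Metric.cthickening δ K) := hK.cthickening
  obtain ⟨B, hB⟩ := hcomp.exists_bound_of_continuousOn ((hu.continuousOn hΩ).mono hsub)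
  refine ⟨2 * B / δ, fun y hy p hp => ?_⟩
  have hyB := hB y (Metric.self_subset_cthickening K hy)
  rcases eq_or_ne p 0 with rfl | hp0
  · have : 0 ≤ B := (norm_nonneg _).trans hyB
    simp only [norm_zero]
    positivity
  have hpn : 0 < ‖p‖ := norm_pos_iff.mpr hp0
  set y' := y + (δ / ‖p‖) • p with hy'
  have hdist : dist y' y = δ := by
    rw [hy', dist_eq_norm, add_sub_cancel_left, norm_smul, Real.norm_of_nonneg (by positivity)]
    field_simp
  have hy'K : y' ∈ Metric.cthickening δ K :=
    Metric.mem_cthickening_of_dist_le y' y δ K hy hdist.le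
  have hy'B := hB y' hy'K
  have h1 := hp y' (hsub hy'K)
  rw [hy', add_sub_cancel_left, inner_smul_right, real_inner_self_eq_norm_sq, ← hy'] at h1
  have h2 : δ / ‖p‖ * ‖p‖ ^ 2 = δ * ‖p‖ := by field_simp
  rw [Real.norm_eq_abs] at hyB hy'B
  rw [le_div_iff₀ hδ]
  have := abs_le.mp hyB
  have := abs_le.mp hy'B
  nlinarith

/-- The graph of the subgradient over a compact set is compact. -/
lemma isCompact_subgrad_graph (hΩ : IsOpen Ω) (hu : ConvexOn ℝ Ω u) {K : Set (En n)}
    (hK : IsCompact K) (hKΩ : K ⊆ Ω) :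
    IsCompact {z : En n × En n | z.1 ∈ K ∧ z.2 ∈ subgrad Ω u z.1} := by
  obtain ⟨M, hM⟩ := exists_subgrad_norm_le hΩ hu hK hKΩ
  have hKM : IsCompact (K ×ˢ Metric.closedBall (0 : En n) M) :=
    hK.prod (isCompact_closedBall _ _)
  refine hKM.of_isClosed_subset ?_ ?_
  · refine IsSeqClosed.isClosed fun z w hz hzw => ?_
    have h1 : Filter.Tendsto (fun k => (z k).1) Filter.atTop (nhds w.1) :=
      (continuous_fst.tendsto w).comp hzw
    have h2 : Filter.Tendsto (fun k => (z k).2) Filter.atTop (nhds w.2) :=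
      (continuous_snd.tendsto w).comp hzw
    have hw : w.1 ∈ K := hK.isClosed.mem_of_tendsto h1 (Filter.Eventually.of_forall fun k => (hz k).1)
    refine ⟨hw, fun y hy => ?_⟩
    have h3 : Filter.Tendsto (fun k => u (z k).1) Filter.atTop (nhds (u w.1)) :=
      ((hu.continuousOn hΩ).continuousAt (hΩ.mem_nhds (hKΩ hw))).tendsto.comp h1
    have h4 : Filter.Tendsto (fun k => u (z k).1 + ⟪(z k).2, y - (z k).1⟫) Filter.atTop
        (nhds (u w.1 + ⟪w.2, y - w.1⟫)) :=
      h3.add (h2.inner (tendsto_const_nhds.sub h1))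
    exact le_of_tendsto' h4 fun k => (hz k).2 y hy
  · rintro ⟨y, p⟩ ⟨h1, h2⟩
    exact ⟨h1, by simpa using hM y h1 p h2⟩

/-- Subgradients at points near `z` are close to subgradients at `z`. -/
lemma exists_subgrad_near (hΩ : IsOpen Ω) (hu : ConvexOn ℝ Ω u) {z : En n} (hz : z ∈ Ω) {ε : ℝ}
    (hε : 0 < ε) : ∃ ρ > 0, ∀ y, ‖y - z‖ < ρ → ∀ q ∈ subgrad Ω u y,
      ∃ p ∈ subgrad Ω u z, ‖q - p‖ < ε := by
  obtain ⟨ρ₁, hρ₁, hsub⟩ := Metric.nhds_basis_closedBall.mem_iff.mp (hΩ.mem_nhds hz)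
  have hΓ := isCompact_subgrad_graph hΩ hu (isCompact_closedBall z ρ₁) hsub
  set Γ := {w : En n × En n | w.1 ∈ Metric.closedBall z ρ₁ ∧ w.2 ∈ subgrad Ω u w.1} with hΓdef
  have hcl : IsClosed {w : En n × En n | ε ≤ Metric.infDist w.2 (subgrad Ω u z)} :=
    isClosed_le continuous_const ((Metric.continuous_infDist_pt _).comp continuous_snd)
  have hΓ' := hΓ.inter_right hcl
  have hne := subgrad_nonempty hΩ hu hz
  have main : ∃ ρ > 0, ∀ w ∈ Γ ∩ {w | ε ≤ Metric.infDist w.2 (subgrad Ω u z)}, ρ ≤ ‖w.1 - z‖ := by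
    rcases (Γ ∩ {w | ε ≤ Metric.infDist w.2 (subgrad Ω u z)}).eq_empty_or_nonempty with he | he
    · exact ⟨1, one_pos, by simp [he]⟩
    · obtain ⟨w, hw, hmin⟩ := hΓ'.exists_isMinOn he
        (f := fun w : En n × En n => ‖w.1 - z‖) (by fun_prop)
      refine ⟨‖w.1 - z‖, ?_, fun w' hw' => hmin hw'⟩
      rw [gt_iff_lt, norm_pos_iff, sub_ne_zero]
      intro h0
      have h1 : w.2 ∈ subgrad Ω u z := h0 ▸ hw.1.2
      have h2 : ε ≤ Metric.infDist w.2 (subgrad Ω u z) := hw.2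
      rw [Metric.infDist_zero_of_mem h1] at h2
      linarith
  obtain ⟨ρ, hρ, hmain⟩ := main
  refine ⟨min ρ ρ₁, lt_min hρ hρ₁, fun y hy q hq => ?_⟩
  have h1 : Metric.infDist q (subgrad Ω u z) < ε := by
    by_contra hcon
    have := hmain (y, q) ⟨⟨by
      rw [Metric.mem_closedBall, dist_eq_norm]
      exact (hy.trans_le (min_le_right _ _)).le, hq⟩, not_lt.mp hcon⟩
    exact absurd (hy.trans_le (min_le_left _ _)) (not_lt.mpr this)
  obtain ⟨p, hp, hlt⟩ := (Metric.infDist_lt_iff hne).mp h1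
  exact ⟨p, hp, by rwa [← dist_eq_norm]⟩

lemma isCompact_subgrad (hΩ : IsOpen Ω) (hu : ConvexOn ℝ Ω u) {z : En n} (hz : z ∈ Ω) :
    IsCompact (subgrad Ω u z) := by
  have h := (isCompact_subgrad_graph hΩ hu (isCompact_singleton (x := z))
    (by simpa using hz)).image continuous_snd
  convert h using 1
  ext p
  simp

end ConvexBasics

section Resolvent

variable {n : ℕ} {Ω : Set (En n)} {u : En n → ℝ}

/-- The image of `A` under the subgradient of `u + |·|² / 2`. -/
def resolventImage (Ω : Set (En n)) (u : En n → ℝ) (A : Set (En n)) : Set (En n) :=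
  {q | ∃ y ∈ A, q - y ∈ subgrad Ω u y}

lemma resolventImage_mono {A B : Set (En n)} (h : A ⊆ B) :
    resolventImage Ω u A ⊆ resolventImage Ω u B :=
  fun _ ⟨y, hy, hq⟩ => ⟨y, h hy, hq⟩

lemma disjoint_resolventImage {A B : Set (En n)} (hA : A ⊆ Ω) (hB : B ⊆ Ω) (h : Disjoint A B) :
    Disjoint (resolventImage Ω u A) (resolventImage Ω u B) := by
  rw [Set.disjoint_left]
  rintro q ⟨y, hy, hq⟩ ⟨y', hy', hq'⟩
  have h1 := hq y' (hB hy')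
  have h2 := hq' y (hA hy)
  have h3 : ⟪q - y, y' - y⟫ + ⟪q - y', y - y'⟫ = ‖y' - y‖ ^ 2 := by
    rw [← real_inner_self_eq_norm_sq, ← neg_sub y' y, inner_neg_right, ← sub_eq_add_neg,
      ← inner_sub_left]
    congr 1
    abel
  have h4 : ‖y' - y‖ = 0 := by
    have := norm_nonneg (y' - y)
    nlinarith
  rw [norm_eq_zero, sub_eq_zero] at h4
  exact Set.disjoint_left.mp h hy (h4 ▸ hy')

lemma isCompact_resolventImage (hΩ : IsOpen Ω) (hu : ConvexOn ℝ Ω u) {K : Set (En n)}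
    (hK : IsCompact K) (hKΩ : K ⊆ Ω) : IsCompact (resolventImage Ω u K) := by
  have h := (isCompact_subgrad_graph hΩ hu hK hKΩ).image (continuous_fst.add continuous_snd)
  convert h using 1
  ext q
  constructor
  · rintro ⟨y, hy, hq⟩
    exact ⟨(y, q - y), ⟨hy, hq⟩, by simp⟩
  · rintro ⟨⟨y, p⟩, ⟨hy, hp⟩, rfl⟩
    exact ⟨y, hy, by simpa using hp⟩

/-- A ball around a point of `resolventImage Ω u {x}` lies in the image of a ball around `x`. -/
lemma closedBall_subset_resolventImage (hΩ : IsOpen Ω) (hu : ConvexOn ℝ Ω u) {x q₀ q : En n}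
    {r : ℝ} (hr : 0 < r) (hball : Metric.closedBall x (3 * r) ⊆ Ω) (hq₀ : q₀ - x ∈ subgrad Ω u x)
    (hq : ‖q - q₀‖ ≤ r) : q ∈ resolventImage Ω u (Metric.closedBall x (2 * r)) := by
  have hxΩ : x ∈ Ω := hball (Metric.mem_closedBall_self (by linarith))
  let F : En n → ℝ := fun y => u y + ‖y - x‖ ^ 2 / 2 - ⟪q - x, y⟫
  have hFc : ContinuousOn F (Metric.closedBall x (3 * r)) :=
    (((hu.continuousOn hΩ).mono hball).add (by fun_prop)).sub (by fun_prop)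
  obtain ⟨y, hy, hmin⟩ := (isCompact_closedBall x (3 * r)).exists_isMinOn
    ⟨x, Metric.mem_closedBall_self (by linarith)⟩ hFc
  have hyx : ‖y - x‖ ≤ 2 * r := by
    have h1 : F y ≤ F x := hmin (Metric.mem_closedBall_self (by linarith))
    have h2 := hq₀ y (hball hy)
    have h3 : ⟪q - x, y⟫ - ⟪q - x, x⟫ = ⟪q - q₀, y - x⟫ + ⟪q₀ - x, y - x⟫ := by
      rw [← inner_sub_right, ← inner_add_left]
      congr 1
      abel
    have h4 := real_inner_le_norm (q - q₀) (y - x)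
    simp only [F, sub_self, norm_zero] at h1
    have h5 : ‖y - x‖ ^ 2 / 2 ≤ r * ‖y - x‖ := by
      have := mul_le_mul_of_nonneg_right hq (norm_nonneg (y - x))
      nlinarith
    by_contra hcon
    push Not at hcon
    nlinarith
  refine ⟨y, by rwa [Metric.mem_closedBall, dist_eq_norm], ?_⟩
  refine affine_le_of_quadratic hu (hball hy) hr fun y' hy' hd => ?_
  have hy'b : y' ∈ Metric.closedBall x (3 * r) := by
    rw [Metric.mem_closedBall, dist_eq_norm]
    calc ‖y' - x‖ = ‖(y' - y) + (y - x)‖ := by congr 1; abel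
      _ ≤ ‖y' - y‖ + ‖y - x‖ := norm_add_le _ _
      _ ≤ 3 * r := by linarith
  have h1 : F y ≤ F y' := hmin hy'b
  have h2 : ‖y' - x‖ ^ 2 = ‖y' - y‖ ^ 2 + 2 * ⟪y' - y, y - x⟫ + ‖y - x‖ ^ 2 := by
    rw [← norm_add_sq_real]
    congr 2
    abel
  have h3 : ⟪q - y, y' - y⟫ = ⟪q - x, y'⟫ - ⟪q - x, y⟫ - ⟪y' - y, y - x⟫ := by
    rw [← inner_sub_right, real_inner_comm (y - x), ← inner_sub_left]
    congr 1
    abel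
  simp only [F] at h1
  linarith

end Resolvent

section RowDet

variable {n : ℕ}

/-- The determinant of the matrix with rows `b i`. -/
def rowDet (b : Fin n → En n) : ℝ := Matrix.det (Matrix.of fun i j => b i j)

lemma rowDet_update_smul (b : Fin n → En n) (i : Fin n) (a : ℝ) (y : En n) :
    rowDet (Function.update b i (a • y)) = a * rowDet (Function.update b i y) := by
  have h : ∀ z : En n, (Matrix.of fun k j => Function.update b i z k j) =
      (Matrix.of fun k j => b k j).updateRow i (fun j => z j) := by
    intro z
    ext k j
    by_cases hk : k = i
    · subst hk; simp
    · simp [hk]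
  unfold rowDet
  rw [h, h, ← Matrix.det_updateRow_smul]
  rfl

lemma abs_rowDet_of_orthonormal {b : Fin n → En n} (hb : Orthonormal ℝ b) : |rowDet b| = 1 := by
  have h : (Matrix.of fun i j => b i j) * (Matrix.of fun i j => b i j).transpose = 1 := by
    ext i j
    rw [Matrix.mul_apply, Matrix.one_apply, ← orthonormal_iff_ite.mp hb i j,
      EuclideanSpace.inner_eq_star_dotProduct]
    simp [dotProduct, mul_comm]
  have h2 := congrArg Matrix.det h
  rw [Matrix.det_mul, Matrix.det_transpose, Matrix.det_one] at h2
  have h3 : rowDet b ^ 2 = 1 := by rw [sq]; exact h2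
  rw [← sq_abs] at h3
  exact (pow_eq_one_iff_of_nonneg (abs_nonneg _) two_ne_zero).mp h3

lemma rowDet_smul_eq_sum (b : Fin n → En n) (y : En n) :
    rowDet b • y = ∑ i, rowDet (Function.update b i y) • b i := by
  have h := Matrix.mulVec_cramer (Matrix.of fun i j => b i j).transpose (fun j => y j)
  ext j
  have hj := congrFun h j
  rw [Matrix.det_transpose] at hj
  simp only [Matrix.mulVec, dotProduct, Matrix.transpose_apply, Matrix.of_apply, Pi.smul_apply,
    smul_eq_mul] at hj
  rw [PiLp.smul_apply, smul_eq_mul, WithLp.ofLp_sum, Finset.sum_apply]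
  unfold rowDet
  rw [← hj]
  refine Finset.sum_congr rfl fun i _ => ?_
  rw [Matrix.cramer_transpose_apply]
  simp only [PiLp.smul_apply, smul_eq_mul]
  rw [mul_comm]
  congr 2
  ext k l
  by_cases hk : k = i
  · subst hk; simp
  · simp [hk]

lemma volume_coordinate_box (l r : Fin n → ℝ) :
    volume {ζ : En n | ∀ i, ζ i ∈ Icc (l i) (r i)} = ∏ i, ENNReal.ofReal (r i - l i) := by
  have h := (EuclideanSpace.volume_preserving_symm_measurableEquiv_toLp (Fin n)).symm
  have h2 := h.measure_preimage_equiv {ζ : En n | ∀ i, ζ i ∈ Icc (l i) (r i)}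
  rw [← h2, ← Real.volume_Icc_pi]
  congr 1
  ext x
  simp [Pi.le_def, forall_and]

/-- The linear map with matrix rows `b i`. -/
lemma exists_linearMap_rows (b : Fin n → En n) :
    ∃ f : En n →ₗ[ℝ] En n, LinearMap.det f = rowDet b ∧ ∀ ξ i, f ξ i = ⟪b i, ξ⟫ := by
  let B := (EuclideanSpace.basisFun (Fin n) ℝ).toBasis
  refine ⟨Matrix.toLin B B (Matrix.of fun i j => b i j), LinearMap.det_toLin _ _, fun ξ i => ?_⟩
  rw [Matrix.toLin_apply]
  simp [B, Matrix.mulVec, dotProduct, EuclideanSpace.inner_eq_star_dotProduct, mul_comm,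
    Pi.single_apply]

lemma exists_linearMap_sum (b : Fin n → En n) :
    ∃ f : En n →ₗ[ℝ] En n, LinearMap.det f = rowDet b ∧ ∀ c, f c = ∑ i, c i • b i := by
  let B := (EuclideanSpace.basisFun (Fin n) ℝ).toBasis
  refine ⟨Matrix.toLin B B (Matrix.of fun i j => b i j).transpose, ?_, fun ξ => ?_⟩
  · rw [LinearMap.det_toLin, Matrix.det_transpose]
    rfl
  · ext j
    rw [Matrix.toLin_apply]
    simp [B, Matrix.mulVec, dotProduct, mul_comm, Pi.single_apply]

lemma volume_dual_box {b : Fin n → En n} (hb : rowDet b ≠ 0) {t : Fin n → ℝ}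
    (ht : ∀ i, 0 ≤ t i) :
    volume {ξ : En n | ∀ i, |⟪b i, ξ⟫| ≤ t i} = ENNReal.ofReal ((∏ i, 2 * t i) / |rowDet b|) := by
  obtain ⟨f, hf, hfa⟩ := exists_linearMap_rows b
  have h : {ξ : En n | ∀ i, |⟪b i, ξ⟫| ≤ t i} =
      f ⁻¹' {ζ : En n | ∀ i, ζ i ∈ Icc (-t i) (t i)} := by
    ext ξ
    simp [hfa, abs_le]
  rw [h, Measure.addHaar_preimage_linearMap _ (hf ▸ hb), volume_coordinate_box, hf,
    ← ENNReal.ofReal_prod_of_nonneg (fun i _ => by linarith [ht i]),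
    ← ENNReal.ofReal_mul (abs_nonneg _), abs_inv, div_eq_inv_mul]
  congr 3
  ext i
  ring

/-- The parallelepiped spanned by `b` with coefficients in a box. -/
def parallelBox (z : En n) (b : Fin n → En n) (l r : Fin n → ℝ) : Set (En n) :=
  {y | ∃ c : En n, (∀ i, c i ∈ Icc (l i) (r i)) ∧ y = z + ∑ i, c i • b i}

lemma volume_parallelBox (z : En n) (b : Fin n → En n) {l r : Fin n → ℝ} (h : ∀ i, l i ≤ r i) :
    volume (parallelBox z b l r) = ENNReal.ofReal (|rowDet b| * ∏ i, (r i - l i)) := by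
  obtain ⟨f, hf, hfa⟩ := exists_linearMap_sum b
  have h1 : parallelBox z b l r =
      (fun y => z + y) '' (f '' {ζ : En n | ∀ i, ζ i ∈ Icc (l i) (r i)}) := by
    ext y
    simp only [parallelBox, mem_image, exists_exists_and_eq_and, mem_ofPred_eq, hfa]
    exact ⟨fun ⟨c, h1, h2⟩ => ⟨c, h1, h2.symm⟩, fun ⟨c, h1, h2⟩ => ⟨c, h1, h2.symm⟩⟩
  rw [h1, image_add_left, measure_preimage_add, Measure.addHaar_image_linearMap,
    volume_coordinate_box, hf, ← ENNReal.ofReal_prod_of_nonneg (fun i _ => by linarith [h i]),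
    ← ENNReal.ofReal_mul (abs_nonneg _)]

lemma isCompact_parallelBox (z : En n) (b : Fin n → En n) (l r : Fin n → ℝ) :
    IsCompact (parallelBox z b l r) := by
  have h : parallelBox z b l r =
      (fun c : Fin n → ℝ => z + ∑ i, c i • b i) '' Icc l r := by
    ext y
    constructor
    · rintro ⟨c, hc, rfl⟩
      exact ⟨fun i => c i, ⟨fun i => (hc i).1, fun i => (hc i).2⟩, rfl⟩
    · rintro ⟨c, hc, rfl⟩
      exact ⟨WithLp.toLp 2 c, fun i => ⟨hc.1 i, hc.2 i⟩, rfl⟩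
  rw [h]
  exact isCompact_Icc.image (by fun_prop)

lemma continuous_rowDet : Continuous (rowDet : (Fin n → En n) → ℝ) := by
  unfold rowDet
  refine Continuous.matrix_det ?_
  refine continuous_matrix fun i j => ?_
  simp only [Matrix.of_apply]
  fun_prop

end RowDet

section Section

variable {n : ℕ} {Ω : Set (En n)} {u : En n → ℝ}

lemma exists_resolvent_mod_orthogonal (hΩ : IsOpen Ω) (hu : ConvexOn ℝ Ω u) {x p ξ : En n}
    {ρ a h : ℝ} (hh : 0 < h) (ha : 0 < a) (haρ : a < ρ)
    (hball : Metric.closedBall x ρ ⊆ Ω) (Q : Submodule ℝ (En n))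
    (hsec : ∀ y ∈ Q, ‖y‖ ≤ ρ → u (x + y) ≤ u x + ⟪p, y⟫ + h → ‖y‖ ≤ a ∧ ⟪ξ, y⟫ ≤ h) :
    ∃ z p' : En n, ‖z‖ ≤ a ∧ p' ∈ subgrad Ω u (x + z) ∧
      ∀ y ∈ Q, ⟪z + p' - p - ξ, y⟫ = 0 := by
  have hρ : 0 < ρ := ha.trans haρ
  have hmem : ∀ y : En n, ‖y‖ ≤ ρ → x + y ∈ Ω := fun y hy => hball (by simpa using hy)
  have hxΩ : x ∈ Ω := by simpa using hmem 0 (by simpa using hρ.le)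
  let F : En n → ℝ := fun y => u (x + y) - ⟪p, y⟫ + ‖y‖ ^ 2 / 2 - ⟪ξ, y⟫
  have hK : IsCompact ((Q : Set (En n)) ∩ Metric.closedBall 0 ρ) :=
    (isCompact_closedBall _ _).inter_left Q.closed_of_finiteDimensional
  have hFc : ContinuousOn F ((Q : Set (En n)) ∩ Metric.closedBall 0 ρ) := by
    have h1 : ContinuousOn (fun y => u (x + y)) ((Q : Set (En n)) ∩ Metric.closedBall 0 ρ) :=
      (hu.continuousOn hΩ).comp (by fun_prop) (fun y hy => hmem y (by simpa using hy.2))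
    exact ((h1.sub (by fun_prop)).add (by fun_prop)).sub (by fun_prop)
  obtain ⟨z, ⟨hzQ, hzρ⟩, hmin⟩ := hK.exists_isMinOn ⟨0, Q.zero_mem, by simpa using hρ.le⟩ hFc
  have hzρ' : ‖z‖ ≤ ρ := by simpa using hzρ
  have hF0 : F z ≤ F 0 := hmin ⟨Q.zero_mem, by simpa using hρ.le⟩
  simp only [F, add_zero, inner_zero_right, norm_zero, sub_zero] at hF0
  have hzsec : u (x + z) ≤ u x + ⟪p, z⟫ + h := by
    by_contra! hlt
    set w := u (x + z) - u x - ⟪p, z⟫ with hw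
    have hwh : h < w := by linarith
    have hw0 : 0 < w := hh.trans hwh
    set t := h / w with ht
    have ht0 : 0 < t := by positivity
    have ht1 : t < 1 := (div_lt_one hw0).2 hwh
    have htw : t * w = h := by rw [ht]; field_simp
    have hc := hu.2 hxΩ (hmem z hzρ') (by linarith : 0 ≤ 1 - t) ht0.le (by ring)
    have he : (1 - t) • x + t • (x + z) = x + t • z := by module
    rw [he, smul_eq_mul, smul_eq_mul] at hc
    have h1 := (hsec (t • z) (Q.smul_mem t hzQ)
      (by
        rw [norm_smul, Real.norm_of_nonneg ht0.le]
        nlinarith [norm_nonneg z])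
      (by
        rw [inner_smul_right]
        nlinarith)).2
    rw [inner_smul_right] at h1
    have h2 : ⟪ξ, z⟫ ≤ w := by
      rw [← htw] at h1
      exact le_of_mul_le_mul_left h1 ht0
    have h3 : ‖z‖ ^ 2 ≤ 0 := by linarith
    have h4 : z = 0 := by
      have : ‖z‖ = 0 := by nlinarith [norm_nonneg z, sq_nonneg ‖z‖]
      simpa using this
    rw [h4] at hw
    simp only [add_zero, inner_zero_right, sub_self] at hw
    linarith
  have hza := (hsec z hzQ hzρ' hzsec).1
  set g := p + ξ - z with hg
  have hCconv : ConvexOn ℝ (Ω ∩ {y | y - x ∈ Q}) u := by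
    refine hu.subset inter_subset_left (hu.1.inter ?_)
    intro y hy y' hy' s t hs ht hst
    have : s • y + t • y' - x = s • (y - x) + t • (y' - x) := by
      rw [smul_sub, smul_sub]
      have : x = s • x + t • x := by rw [← add_smul, hst, one_smul]
      nth_rewrite 1 [this]
      abel
    show s • y + t • y' - x ∈ Q
    rw [this]
    exact Q.add_mem (Q.smul_mem _ hy) (Q.smul_mem _ hy')
  have hglob := affine_le_of_quadratic hCconv (y₀ := x + z) (g := g)
    ⟨hmem z hzρ', by simpa using hzQ⟩ (ρ := ρ - a) (by linarith) (by
      rintro y ⟨hy, hyQ⟩ hyn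
      have hyQ' : y - x ∈ Q := hyQ
      have hn : ‖y - x‖ ≤ ρ := by
        have : y - x = (y - (x + z)) + z := by abel
        rw [this]
        exact (norm_add_le _ _).trans (by linarith)
      have h1 : F z ≤ F (y - x) := hmin ⟨hyQ', by simpa using hn⟩
      simp only [F, add_sub_cancel] at h1
      set v := y - (x + z) with hv
      have hyx : y - x = z + v := by rw [hv]; abel
      rw [hyx, norm_add_sq_real, inner_add_right, inner_add_right] at h1
      rw [hg, inner_sub_left, inner_add_left]
      linarith)
  obtain ⟨p', hp', hpQ⟩ := exists_subgrad_extending (g := g) hΩ hu (hmem z hzρ') Q (by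
    intro y hy hyΩ
    have h1 := hglob (x + z + y) ⟨hyΩ, by
      show x + z + y - x ∈ Q
      have : x + z + y - x = z + y := by abel
      rw [this]
      exact Q.add_mem hzQ hy⟩
    simpa using h1)
  refine ⟨z, p', hza, hp', fun y hy => ?_⟩
  have h1 := hpQ y hy
  have h2 : z + p' - p - ξ = p' - g := by rw [hg]; abel
  rw [h2, inner_sub_left, h1, sub_self]

lemma volume_le_resolventImage (hΩ : IsOpen Ω) (hu : ConvexOn ℝ Ω u) {x p : En n}
    {ρ a h N : ℝ} (hh : 0 < h) (ha : 0 < a) (haρ : 4 * a ≤ ρ)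
    (hN : 0 ≤ N) (hball : Metric.closedBall x ρ ⊆ Ω) (Q : Submodule ℝ (En n)) (A : Set (En n))
    (hsec : ∀ y ∈ Q, ‖y‖ ≤ ρ → u (x + y) ≤ u x + ⟪p, y⟫ + h →
      ‖y‖ ≤ a ∧ ∀ ξ ∈ A, ⟪ξ, y⟫ ≤ h)
    (hA : ∀ ξ ∈ A, ∃ v, ‖v‖ ≤ N * a ∧ ξ - v ∈ Q ∧ ∀ y ∈ Q, ⟪v, y⟫ = 0) :
    volume A ≤ ENNReal.ofReal ((5 + 2 * N) ^ n) *
      volume (resolventImage Ω u (Metric.closedBall x (3 * a))) := by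
  have hex : ∀ ξ : A, ∃ q : En n, Metric.closedBall q a ⊆
      resolventImage Ω u (Metric.closedBall x (3 * a)) ∧
      ∀ y ∈ Q, ⟪q - (x + p) - ξ, y⟫ = 0 := by
    rintro ⟨ξ, hξ⟩
    obtain ⟨z, p', hz, hp', hzQ⟩ := exists_resolvent_mod_orthogonal hΩ hu (p := p) (ξ := ξ) hh ha
      (by linarith) hball Q (fun y hy h1 h2 => ⟨(hsec y hy h1 h2).1, (hsec y hy h1 h2).2 ξ hξ⟩)
    refine ⟨x + z + p', fun q hq => ?_, fun y hy => ?_⟩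
    · refine resolventImage_mono ?_ (closedBall_subset_resolventImage hΩ hu (x := x + z)
        (q₀ := x + z + p') ha ?_ (by simpa using hp') (by simpa [dist_eq_norm] using hq))
      · refine Metric.closedBall_subset_closedBall' ?_
        simp only [dist_eq_norm, add_sub_cancel_left]
        linarith
      · refine (Metric.closedBall_subset_closedBall' ?_).trans hball
        simp only [dist_eq_norm, add_sub_cancel_left]
        linarith
    · have : x + z + p' - (x + p) - ξ = z + p' - p - ξ := by abel
      rw [this, hzQ y hy]
  choose q hqG hqQ using hex
  obtain ⟨F, -, hFd, hF⟩ := Vitali.exists_disjoint_subfamily_covering_enlargement_closedBall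
    (univ : Set A) q (fun _ => a) a (fun _ _ => le_rfl) 5 (by norm_num)
  have hFc : F.Countable := by
    refine hFd.countable_of_nonempty_interior fun i _ => ?_
    rw [interior_closedBall _ ha.ne']
    exact ⟨q i, Metric.mem_ball_self ha⟩
  have hcov : A ⊆ ⋃ f ∈ F, Metric.closedBall (f : En n) ((5 + 2 * N) * a) := by
    intro ξ hξ
    obtain ⟨f, hfF, hf⟩ := hF ⟨ξ, hξ⟩ (mem_univ _)
    have hd : ‖q ⟨ξ, hξ⟩ - q f‖ ≤ 5 * a := by
      have := hf (Metric.mem_closedBall_self ha.le)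
      simpa [dist_eq_norm] using this
    refine mem_iUnion₂.2 ⟨f, hfF, ?_⟩
    rw [Metric.mem_closedBall, dist_eq_norm]
    obtain ⟨v, hv, hvQ, hvo⟩ := hA ξ hξ
    obtain ⟨v', hv', hvQ', hvo'⟩ := hA f f.2
    set k := (ξ - v) - (f - v') with hk
    have hkQ : k ∈ Q := Q.sub_mem hvQ hvQ'
    have h1 : ⟪q ⟨ξ, hξ⟩ - q f, k⟫ = ‖k‖ ^ 2 := by
      have e : q ⟨ξ, hξ⟩ - q f = k + v - v' + (q ⟨ξ, hξ⟩ - (x + p) - ξ) -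
          (q f - (x + p) - f) := by
        rw [hk]; abel
      rw [e, inner_sub_left, inner_add_left, inner_sub_left, inner_add_left, hqQ f k hkQ,
        hqQ ⟨ξ, hξ⟩ k hkQ, hvo k hkQ, hvo' k hkQ, real_inner_self_eq_norm_sq]
      ring
    have h2 : ‖k‖ ≤ 5 * a := by
      have h3 := real_inner_le_norm (q ⟨ξ, hξ⟩ - q f) k
      rw [h1] at h3
      rcases (norm_nonneg k).eq_or_lt with h0 | h0
      · rw [← h0]; positivity
      · have : ‖k‖ ≤ ‖q ⟨ξ, hξ⟩ - q f‖ := by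
          rw [sq] at h3
          exact le_of_mul_le_mul_right h3 h0
        exact this.trans hd
    have e : ξ - f = k + (v - v') := by rw [hk]; abel
    rw [e]
    have h3 := norm_add_le k (v - v')
    have h4 := norm_sub_le v v'
    nlinarith
  calc volume A ≤ volume (⋃ f ∈ F, Metric.closedBall (f : En n) ((5 + 2 * N) * a)) :=
        measure_mono hcov
    _ ≤ ∑' f : F, volume (Metric.closedBall ((f : A) : En n) ((5 + 2 * N) * a)) :=
        measure_biUnion_le _ hFc _
    _ = ∑' f : F, ENNReal.ofReal ((5 + 2 * N) ^ n) * volume (Metric.closedBall (q f) a) := by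
        refine tsum_congr fun f => ?_
        rw [Measure.addHaar_closedBall_mul _ _ (by positivity) ha.le,
          Measure.addHaar_closedBall_center _ (q f) a, finrank_euclideanSpace_fin]
    _ = ENNReal.ofReal ((5 + 2 * N) ^ n) * volume (⋃ f ∈ F, Metric.closedBall (q f) a) := by
        rw [ENNReal.tsum_mul_left, measure_biUnion hFc hFd
          (fun _ _ => Metric.isClosed_closedBall.measurableSet)]
    _ ≤ _ := by
        gcongr
        exact iUnion₂_subset fun f _ => hqG f

lemma prod_ite_lt {m : ℕ} (hm : m ≤ n) (s t : ℝ) :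
    ∏ i : Fin n, (if (i : ℕ) < m then s else t) = s ^ m * t ^ (n - m) := by
  rw [Fin.prod_univ_eq_prod_range (fun i => if i < m then s else t) n,
    ← Finset.prod_range_mul_prod_Ico _ hm]
  congr 1
  · rw [Finset.prod_congr rfl (g := fun _ => s)]
    · simp
    · intro i hi; simp [Finset.mem_range.1 hi]
  · rw [Finset.prod_congr rfl (g := fun _ => t)]
    · simp
    · intro i hi; simp [(Finset.mem_Ico.1 hi).1]

lemma section_volume_le (hΩ : IsOpen Ω) (hu : ConvexOn ℝ Ω u) {x p : En n}
    {ρ a h : ℝ} (hh : 0 < h) (ha : 0 < a) (haρ : 4 * a ≤ ρ)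
    (hball : Metric.closedBall x ρ ⊆ Ω) {b : Fin n → En n} (hb : rowDet b ≠ 0) {m : ℕ}
    (hm : m ≤ n)
    (hon : ∀ i j : Fin n, m ≤ i → m ≤ j → ⟪b i, b j⟫ = if i = j then (1 : ℝ) else 0)
    (hsec : ∀ y : En n, (∀ j : Fin n, m ≤ j → ⟪b j, y⟫ = 0) → ‖y‖ ≤ ρ →
      u (x + y) ≤ u x + ⟪p, y⟫ + h →
      ‖y‖ ≤ a ∧ ∀ ξ : En n, (∀ i : Fin n, i < m → |⟪b i, ξ⟫| ≤ h / n) → ⟪ξ, y⟫ ≤ h) :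
    ENNReal.ofReal ((2 * h / n) ^ m * (2 * a) ^ (n - m) / |rowDet b|) ≤
      ENNReal.ofReal ((5 + 2 * n) ^ n) *
        volume (resolventImage Ω u (Metric.closedBall x (3 * a))) := by
  let t : Fin n → ℝ := fun i => if (i : ℕ) < m then h / n else a
  have ht : ∀ i, 0 ≤ t i := fun i => by
    simp only [t]
    split_ifs <;> positivity
  have hprod : ∏ i, 2 * t i = (2 * h / n) ^ m * (2 * a) ^ (n - m) := by
    rw [← prod_ite_lt hm]
    refine Finset.prod_congr rfl fun i _ => ?_
    simp only [t]
    split_ifs <;> ring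
  rw [← hprod, ← volume_dual_box hb ht]
  let Q : Submodule ℝ (En n) :=
    { carrier := {y | ∀ j : Fin n, m ≤ j → ⟪b j, y⟫ = 0}
      add_mem' := fun {y y'} hy hy' j hj => by rw [inner_add_right, hy j hj, hy' j hj, add_zero]
      zero_mem' := fun j _ => inner_zero_right _
      smul_mem' := fun c y hy j hj => by rw [inner_smul_right, hy j hj, mul_zero] }
  refine volume_le_resolventImage (p := p) hΩ hu hh ha haρ (Nat.cast_nonneg n) hball Q _ ?_ ?_
  · intro y hy h1 h2
    refine ⟨(hsec y hy h1 h2).1, fun ξ hξ => (hsec y hy h1 h2).2 ξ fun i hi => ?_⟩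
    have := hξ i
    simpa [t, hi] using this
  · intro ξ hξ
    refine ⟨∑ j : Fin n, if m ≤ j then ⟪b j, ξ⟫ • b j else 0, ?_, ?_, ?_⟩
    · refine (norm_sum_le _ _).trans ?_
      calc ∑ j : Fin n, ‖(if m ≤ (j : ℕ) then ⟪b j, ξ⟫ • b j else 0 : En n)‖
          ≤ ∑ j : Fin n, a := by
            refine Finset.sum_le_sum fun j _ => ?_
            split_ifs with hj
            · have h1 := hξ j
              have h2 : ‖b j‖ = 1 := by
                have := hon j j hj hj
                rw [if_pos rfl, real_inner_self_eq_norm_sq] at this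
                exact (pow_eq_one_iff_of_nonneg (norm_nonneg _) two_ne_zero).mp this
              rw [norm_smul, h2, mul_one, Real.norm_eq_abs]
              simpa [t, not_lt.2 hj] using h1
            · simpa using ha.le
        _ = n * a := by simp
    · intro j hj
      rw [inner_sub_right, inner_sum, Finset.sum_eq_single j]
      · rw [if_pos hj, inner_smul_right, hon j j hj hj, if_pos rfl, mul_one, sub_self]
      · intro i _ hij
        split_ifs with hi
        · rw [inner_smul_right, hon j i hj hi, if_neg hij.symm, mul_zero]
        · simp
      · simp
    · intro y hy
      rw [sum_inner]
      refine Finset.sum_eq_zero fun j _ => ?_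
      split_ifs with hj
      · rw [inner_smul_left, hy j hj, mul_zero]
      · simp

end Section

section Induction

variable {n : ℕ}

/-- The members of the family `b` with index at least `m` are orthonormal. -/
def OrthonormalFrom (m : ℕ) (b : Fin n → En n) : Prop :=
  ∀ i j : Fin n, m ≤ i → m ≤ j → ⟪b i, b j⟫ = if i = j then (1 : ℝ) else 0

lemma OrthonormalFrom.update {m : ℕ} (hm : m < n) {b : Fin n → En n}
    (hb : OrthonormalFrom (m + 1) b) {f : En n} (hf : ‖f‖ = 1)
    (hbf : ∀ j : Fin n, m + 1 ≤ j → ⟪b j, f⟫ = 0) :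
    OrthonormalFrom m (Function.update b ⟨m, hm⟩ f) := by
  intro i j hi hj
  by_cases hi' : i = ⟨m, hm⟩ <;> by_cases hj' : j = ⟨m, hm⟩
  · subst hi' hj'
    simp [hf]
  · subst hi'
    have hj1 : m + 1 ≤ j := by
      have : (j : ℕ) ≠ m := fun h => hj' (Fin.ext h)
      omega
    rw [Function.update_self, Function.update_of_ne hj', real_inner_comm, hbf j hj1,
      if_neg (Ne.symm hj')]
  · subst hj'
    have hi1 : m + 1 ≤ i := by
      have : (i : ℕ) ≠ m := fun h => hi' (Fin.ext h)
      omega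
    rw [Function.update_self, Function.update_of_ne hi', hbf i hi1, if_neg hi']
  · rw [Function.update_of_ne hi', Function.update_of_ne hj']
    refine hb i j ?_ ?_
    · have : (i : ℕ) ≠ m := fun h => hi' (Fin.ext h)
      omega
    · have : (j : ℕ) ≠ m := fun h => hj' (Fin.ext h)
      omega

lemma OrthonormalFrom.abs_rowDet {b : Fin n → En n} (hb : OrthonormalFrom 0 b) :
    |rowDet b| = 1 :=
  abs_rowDet_of_orthonormal
    (orthonormal_iff_ite.2 fun i j => hb i j (Nat.zero_le _) (Nat.zero_le _))

lemma exists_unit_orthogonal_tail {m : ℕ} (hm : m < n) (b : Fin n → En n) :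
    ∃ f : En n, ‖f‖ = 1 ∧ ∀ j : Fin n, m + 1 ≤ j → ⟪b j, f⟫ = 0 := by
  let W := Submodule.span ℝ (range fun j : {j : Fin n // m + 1 ≤ j} => b j)
  have h1 : Module.finrank ℝ W < n := by
    refine (finrank_range_le_card _).trans_lt ?_
    conv_rhs => rw [← Fintype.card_fin n]
    exact Fintype.card_subtype_lt (x := ⟨m, hm⟩) (by simp)
  have h2 := Submodule.finrank_add_finrank_orthogonal W
  rw [finrank_euclideanSpace_fin] at h2
  have h3 : Wᗮ ≠ ⊥ := by
    intro h
    rw [h, finrank_bot] at h2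
    omega
  obtain ⟨y, hy, hy0⟩ := Submodule.exists_mem_ne_zero_of_ne_bot h3
  refine ⟨(‖y‖⁻¹ : ℝ) • y, norm_smul_inv_norm hy0, fun j hj => ?_⟩
  rw [inner_smul_right, (Submodule.mem_orthogonal W y).1 hy (b j)
    (Submodule.subset_span ⟨⟨j, hj⟩, rfl⟩), mul_zero]

/-- A maximal-volume tuple controls its span: every competitor is a combination of its members
with coefficients in `[-1, 1]`. -/
lemma inner_le_of_rowDet_maximal {m : ℕ} {b : Fin n → En n} (hb0 : rowDet b ≠ 0)
    (hb : OrthonormalFrom m b)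
    (hperp : ∀ i : Fin n, i < m → ∀ j : Fin n, m ≤ j → ⟪b j, b i⟫ = 0) {y : En n}
    (hy : ∀ j : Fin n, m ≤ j → ⟪b j, y⟫ = 0)
    (hmax : ∀ i : Fin n, i < m → |rowDet (Function.update b i y)| ≤ |rowDet b|) {t : ℝ}
    (ht : 0 ≤ t) {ξ : En n} (hξ : ∀ i : Fin n, i < m → |⟪b i, ξ⟫| ≤ t / n) : ⟪ξ, y⟫ ≤ t := by
  have hC := rowDet_smul_eq_sum b y
  have htail : ∀ j : Fin n, m ≤ j → rowDet (Function.update b j y) = 0 := by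
    intro j hj
    have h1 := congrArg (fun z => ⟪b j, z⟫) hC
    simp only [inner_smul_right, hy j hj, mul_zero, inner_sum] at h1
    rw [Finset.sum_eq_single j] at h1
    · rw [hb j j hj hj, if_pos rfl, mul_one] at h1
      exact h1.symm
    · intro i _ hij
      rcases lt_or_ge (i : ℕ) m with hi | hi
      · rw [hperp i hi j hj, mul_zero]
      · rw [hb j i hj hi, if_neg hij.symm, mul_zero]
    · simp
  have hD : 0 < |rowDet b| := abs_pos.2 hb0
  have h1 : rowDet b * ⟪ξ, y⟫ = ∑ i, rowDet (Function.update b i y) * ⟪ξ, b i⟫ := by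
    have := congrArg (fun z => ⟪ξ, z⟫) hC
    simpa only [inner_smul_right, inner_sum] using this
  have h2 : |rowDet b| * |⟪ξ, y⟫| ≤ |rowDet b| * t := by
    rw [← abs_mul, h1]
    refine (Finset.abs_sum_le_sum_abs _ _).trans ?_
    calc ∑ i, |rowDet (Function.update b i y) * ⟪ξ, b i⟫|
        ≤ ∑ _i : Fin n, |rowDet b| * (t / n) := by
          refine Finset.sum_le_sum fun i _ => ?_
          rcases lt_or_ge (i : ℕ) m with hi | hi
          · rw [abs_mul, real_inner_comm]
            exact mul_le_mul (hmax i hi) (hξ i hi) (abs_nonneg _) (abs_nonneg _)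
          · rw [htail i hi, zero_mul, abs_zero]
            positivity
      _ = |rowDet b| * (n * (t / n)) := by
          rw [Finset.sum_const, Finset.card_univ, Fintype.card_fin, nsmul_eq_mul]; ring
      _ ≤ |rowDet b| * t := by
          gcongr
          by_cases hn : (n : ℝ) = 0
          · simpa [hn] using ht
          · exact (mul_div_cancel₀ t hn).le
  exact (le_abs_self _).trans (le_of_mul_le_mul_left h2 hD)

open Filter Topology in
lemma eventually_exists_large_rowDet {S : ℝ → Set (En n)} {e : En n} {c ρ : ℝ} (hc : 0 < c)
    (hρ : 0 < ρ) (hS : ∀ᶠ σ in 𝓝[>] (0 : ℝ), IsCompact (S σ))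
    (hlong : ∀ N : ℝ, ∀ᶠ σ in 𝓝[>] (0 : ℝ), ∀ f : En n, ‖f‖ = 1 → ⟪e, f⟫ = 0 →
      ∃ s : ℝ, N * σ ^ 2 ≤ |s| ∧ s • f ∈ S σ)
    (hvol : ∀ᶠ σ in 𝓝[>] (0 : ℝ), ∀ m : ℕ, 1 ≤ m → m < n → ∀ a : ℝ, 0 < a → a ≤ ρ →
      ∀ b : Fin n → En n, OrthonormalFrom m b → (∀ j : Fin n, (j : ℕ) + 1 = n → b j = e) →
      rowDet b ≠ 0 →
      (∀ y ∈ S σ, (∀ j : Fin n, m ≤ j → ⟪b j, y⟫ = 0) → ‖y‖ ≤ a ∧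
        ∀ ξ : En n, (∀ i : Fin n, i < m → |⟪b i, ξ⟫| ≤ σ ^ 2 / n) → ⟪ξ, y⟫ ≤ σ ^ 2) →
      c * σ ^ (2 * m) ≤ |rowDet b| * a ^ (m - 1))
    (m : ℕ) (hm : m < n) (N : ℝ) :
    ∀ᶠ σ in 𝓝[>] (0 : ℝ), ∀ g : Fin n → En n, OrthonormalFrom m g →
      (∀ j : Fin n, (j : ℕ) + 1 = n → g j = e) →
      ∃ b : Fin n → En n, (∀ j : Fin n, m ≤ j → b j = g j) ∧
        (∀ i : Fin n, i < m → b i ∈ S σ ∧ ∀ j : Fin n, m ≤ j → ⟪g j, b i⟫ = 0) ∧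
        N * σ ^ (m + 1) ≤ |rowDet b| := by
  have hpos : ∀ᶠ σ in 𝓝[>] (0 : ℝ), 0 < σ := eventually_mem_nhdsWithin
  have hsmall : ∀ ε > 0, ∀ᶠ σ in 𝓝[>] (0 : ℝ), σ < ε := fun ε hε =>
    mem_nhdsWithin_of_mem_nhds (Iio_mem_nhds hε)
  induction m generalizing N with
  | zero =>
    filter_upwards [hpos, hsmall (1 / (|N| + 1)) (by positivity)] with σ hσ hσ1 g hg _
    refine ⟨g, fun _ _ => rfl, fun i hi => absurd hi (Nat.not_lt_zero _), ?_⟩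
    rw [hg.abs_rowDet, zero_add, pow_one]
    rw [lt_div_iff₀ (by positivity)] at hσ1
    nlinarith [le_abs_self N, abs_nonneg N]
  | succ m ih =>
    have hm' : m < n := by omega
    set k : Fin n := ⟨m, hm'⟩ with hk
    rcases Nat.eq_zero_or_pos m with hm0 | hmpos
    · filter_upwards [hlong N] with σ hσ g hg hge
      obtain ⟨f, hf, hgf⟩ := exists_unit_orthogonal_tail hm' g
      have hlast : (⟨n - 1, by omega⟩ : Fin n).val + 1 = n := by simp; omega
      obtain ⟨s, hs, hsS⟩ := hσ f hf (by
        rw [← hge ⟨n - 1, by omega⟩ hlast]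
        exact hgf _ (by simp; omega))
      have hup := hg.update hm' hf hgf
      refine ⟨Function.update g k (s • f), fun j hj => ?_, fun i hi => ?_, ?_⟩
      · refine Function.update_of_ne ?_ _ _
        rintro rfl
        simp [hk] at hj
      · have hik : i = k := Fin.ext (by simp [hk]; omega)
        subst hik
        rw [Function.update_self]
        exact ⟨hsS, fun j hj => by rw [inner_smul_right, hgf j hj, mul_zero]⟩
      · subst hm0
        rw [rowDet_update_smul, abs_mul, OrthonormalFrom.abs_rowDet hup, mul_one]
        simpa using hs
    · set N' := max N 1 with hN'
      have hN1 : 1 ≤ N' := le_max_right _ _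
      set δ := min 1 (c / N') with hδ
      have hδ0 : 0 < δ := lt_min one_pos (by positivity)
      have hδc : N' * δ ^ m ≤ c := by
        have h1 : δ ^ m ≤ δ := pow_le_of_le_one hδ0.le (min_le_left _ _) hmpos.ne'
        have h2 : δ ≤ c / N' := min_le_right _ _
        rw [le_div_iff₀ (by linarith)] at h2
        nlinarith
      filter_upwards [hpos, hS, hlong 1, hvol, ih hm' (N' / δ), hsmall (ρ / δ) (by positivity)]
        with σ hσ hSσ hlongσ hvolσ ihσ hσρ g hg hge
      let T : Set (En n) := {y | ∀ j : Fin n, m + 1 ≤ j → ⟪g j, y⟫ = 0}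
      have hTc : IsClosed T := by
        have : T = ⋂ j : Fin n, {y | m + 1 ≤ (j : ℕ) → ⟪g j, y⟫ = 0} := by
          ext y; simp [T]
        rw [this]
        refine isClosed_iInter fun j => ?_
        by_cases hj : m + 1 ≤ (j : ℕ)
        · simp only [hj, forall_const]
          exact isClosed_eq (by fun_prop) continuous_const
        · simp [hj]
      have hST : IsCompact (S σ ∩ T) := hSσ.inter_right hTc
      obtain ⟨f, hf, hgf⟩ := exists_unit_orthogonal_tail hm' g
      have hlast : (⟨n - 1, by omega⟩ : Fin n).val + 1 = n := by simp; omega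
      obtain ⟨s, hs, hsS⟩ := hlongσ f hf (by
        rw [← hge ⟨n - 1, by omega⟩ hlast]
        exact hgf _ (by simp; omega))
      have hsT : s • f ∈ S σ ∩ T :=
        ⟨hsS, fun j hj => by rw [inner_smul_right, hgf j hj, mul_zero]⟩
      obtain ⟨y, ⟨hyS, hyT⟩, hymax⟩ := hST.exists_isMaxOn ⟨_, hsT⟩ continuous_norm.continuousOn
      have hy0 : 0 < ‖y‖ := by
        refine lt_of_lt_of_le ?_ (hymax hsT)
        simp only [norm_smul, hf, mul_one, Real.norm_eq_abs]
        refine lt_of_lt_of_le ?_ hs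
        positivity
      have hup : OrthonormalFrom m (Function.update g k (‖y‖⁻¹ • y)) :=
        hg.update hm' (norm_smul_inv_norm (norm_pos_iff.1 hy0)) fun j hj => by
          rw [inner_smul_right, hyT j hj, mul_zero]
      have hne : ∀ j : Fin n, m + 1 ≤ j → j ≠ k := by
        rintro j hj rfl
        simp [hk] at hj
      obtain ⟨b', hb'tail, hb'S, hb'det⟩ := ihσ _ hup (fun j hj => by
        rw [Function.update_of_ne (hne j (by omega)), hge j hj])
      have hb'k : b' k = ‖y‖⁻¹ • y := by rw [hb'tail k le_rfl, Function.update_self]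
      set b₁ := Function.update b' k y with hb₁
      have hb₁det : |rowDet b₁| = ‖y‖ * |rowDet b'| := by
        have h1 : y = ‖y‖ • b' k := by
          rw [hb'k, smul_smul, mul_inv_cancel₀ hy0.ne', one_smul]
        rw [hb₁]
        nth_rewrite 1 [h1]
        rw [rowDet_update_smul, Function.update_eq_self, abs_mul, abs_norm]
      have hb₁tail : ∀ j : Fin n, m + 1 ≤ j → b₁ j = g j := fun j hj => by
        rw [hb₁, Function.update_of_ne (hne j hj), hb'tail j (by omega),
          Function.update_of_ne (hne j hj)]
      have hb₁S : ∀ i : Fin n, (i : ℕ) < m + 1 → b₁ i ∈ S σ ∩ T := by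
        intro i hi
        by_cases hik : i = k
        · rw [hik, hb₁, Function.update_self]
          exact ⟨hyS, hyT⟩
        · have him : (i : ℕ) < m := by
            have : (i : ℕ) ≠ m := fun h => hik (Fin.ext h)
            omega
          rw [hb₁, Function.update_of_ne hik]
          refine ⟨(hb'S i him).1, fun j hj => ?_⟩
          have := (hb'S i him).2 j (by omega)
          rwa [Function.update_of_ne (hne j hj)] at this
      have hNσ : N * σ ^ (m + 1 + 1) ≤ N' * σ ^ (m + 1 + 1) := by
        gcongr
        exact le_max_left _ _
      rcases le_or_gt (δ * σ) ‖y‖ with hcase | hcase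
      · refine ⟨b₁, hb₁tail, fun i hi => hb₁S i hi, hNσ.trans ?_⟩
        rw [hb₁det]
        calc N' * σ ^ (m + 1 + 1) = (δ * σ) * (N' / δ * σ ^ (m + 1)) := by
              field_simp
              ring
          _ ≤ ‖y‖ * |rowDet b'| := by gcongr
      · let B : Set (Fin n → En n) :=
          Set.pi univ fun i => if (i : ℕ) < m + 1 then S σ ∩ T else {g i}
        have hB : IsCompact B := isCompact_univ_pi fun i => by
          split_ifs
          · exact hST
          · exact isCompact_singleton
        have hmemB : ∀ b : Fin n → En n, b ∈ B ↔ (∀ j : Fin n, m + 1 ≤ j → b j = g j) ∧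
            ∀ i : Fin n, (i : ℕ) < m + 1 → b i ∈ S σ ∩ T := by
          intro b
          simp only [B, mem_univ_pi]
          constructor
          · intro h
            refine ⟨fun j hj => ?_, fun i hi => ?_⟩
            · have := h j
              rwa [if_neg (by omega)] at this
            · have := h i
              rwa [if_pos hi] at this
          · rintro ⟨h1, h2⟩ i
            split_ifs with hi
            · exact h2 i hi
            · exact h1 i (by omega)
        have hb₁B : b₁ ∈ B := (hmemB _).2 ⟨hb₁tail, hb₁S⟩
        obtain ⟨b, hbB, hbmax⟩ := hB.exists_isMaxOn ⟨_, hb₁B⟩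
          continuous_rowDet.abs.continuousOn
        obtain ⟨hbtail, hbS⟩ := (hmemB b).1 hbB
        refine ⟨b, hbtail, fun i hi => hbS i hi, hNσ.trans ?_⟩
        have hbdet : rowDet b ≠ 0 := by
          have h1 : |rowDet b₁| ≤ |rowDet b| := hbmax hb₁B
          rw [hb₁det] at h1
          have h2 : 0 < |rowDet b'| := lt_of_lt_of_le (by positivity) hb'det
          exact abs_pos.1 (lt_of_lt_of_le (by positivity) h1)
        have hbo : OrthonormalFrom (m + 1) b := fun i j hi hj => by
          rw [hbtail i hi, hbtail j hj]
          exact hg i j hi hj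
        have h1 := hvolσ (m + 1) (by omega) hm (δ * σ) (by positivity)
          (by rw [lt_div_iff₀ hδ0] at hσρ; linarith) b hbo
          (fun j hj => by rw [hbtail j (by omega), hge j hj]) hbdet (by
            intro y' hy'S hy'T
            have hy'T' : y' ∈ T := fun j hj => by rw [← hbtail j hj]; exact hy'T j hj
            refine ⟨?_, fun ξ hξ => ?_⟩
            · have h2 : ‖y'‖ ≤ ‖y‖ := hymax ⟨hy'S, hy'T'⟩
              linarith
            · refine inner_le_of_rowDet_maximal hbdet hbo ?_ hy'T ?_ (sq_nonneg σ) hξ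
              · intro i hi j hj
                rw [hbtail j hj]
                exact (hbS i hi).2 j hj
              · intro i hi
                refine hbmax ((hmemB _).2 ⟨fun j hj => ?_, fun i' hi' => ?_⟩)
                · rw [Function.update_of_ne (by rintro rfl; omega), hbtail j hj]
                · by_cases hii : i' = i
                  · rw [hii, Function.update_self]
                    exact ⟨hy'S, hy'T'⟩
                  · rw [Function.update_of_ne hii]
                    exact hbS i' hi')
        rw [Nat.add_sub_cancel] at h1
        have h2 : 0 < (δ * σ) ^ m := by positivity
        refine le_of_mul_le_mul_right ?_ h2
        calc N' * σ ^ (m + 1 + 1) * (δ * σ) ^ m = N' * δ ^ m * σ ^ (2 * (m + 1)) := by ring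
          _ ≤ c * σ ^ (2 * (m + 1)) := by gcongr
          _ ≤ _ := h1

end Induction

section Dichotomy

variable {n : ℕ} {Ω : Set (En n)} {u : En n → ℝ}

lemma exists_ray_or_plane {K : Set (En n)} (hK : IsCompact K) (hne : K.Nonempty) :
    (∃ p ∈ K, ∃ ν : En n, ∀ p' ∈ K, ∃ t : ℝ, t ≤ 0 ∧ p' = p + t • ν) ∨
    ∃ p v₁ v₂ : En n, v₁ ≠ 0 ∧ v₂ ∉ Submodule.span ℝ {v₁} ∧ p ∈ K ∧ p + v₁ ∈ K ∧ p + v₂ ∈ K := by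
  obtain ⟨p₀, hp₀⟩ := hne
  by_cases h1 : ∃ p₁ ∈ K, p₁ ≠ p₀
  · obtain ⟨p₁, hp₁, hne⟩ := h1
    by_cases h2 : ∃ p₂ ∈ K, p₂ - p₀ ∉ Submodule.span ℝ {p₁ - p₀}
    · obtain ⟨p₂, hp₂, h⟩ := h2
      exact Or.inr ⟨p₀, p₁ - p₀, p₂ - p₀, sub_ne_zero.2 hne, h, hp₀, by simpa, by simpa⟩
    · push Not at h2
      left
      obtain ⟨p, hp, hmax⟩ := hK.exists_isMaxOn ⟨p₀, hp₀⟩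
        (f := fun q => ⟪p₁ - p₀, q⟫) (by fun_prop)
      refine ⟨p, hp, p₁ - p₀, fun p' hp' => ?_⟩
      obtain ⟨s, hs⟩ := Submodule.mem_span_singleton.1 (h2 p hp)
      obtain ⟨s', hs'⟩ := Submodule.mem_span_singleton.1 (h2 p' hp')
      refine ⟨s' - s, ?_, ?_⟩
      · have h3 : ⟪p₁ - p₀, p'⟫ ≤ ⟪p₁ - p₀, p⟫ := hmax hp'
        have e1 : p' = p₀ + s' • (p₁ - p₀) := by rw [hs']; abel
        have e2 : p = p₀ + s • (p₁ - p₀) := by rw [hs]; abel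
        rw [e1, e2, inner_add_right, inner_add_right, inner_smul_right, inner_smul_right] at h3
        have h4 : 0 < ⟪p₁ - p₀, p₁ - p₀⟫ := real_inner_self_pos.2 (sub_ne_zero.2 hne)
        nlinarith
      · rw [sub_smul, hs, hs']; abel
  · push Not at h1
    exact Or.inl ⟨p₀, hp₀, 0, fun p' hp' => ⟨0, le_rfl, by simp [h1 p' hp']⟩⟩

lemma inner_neg_of_lt (hΩ : IsOpen Ω) (hu : ConvexOn ℝ Ω u) {z p ν : En n} (hz : z ∈ Ω)
    (hK : ∀ p' ∈ subgrad Ω u z, ∃ t : ℝ, t ≤ 0 ∧ p' = p + t • ν) {N : ℝ} (hN : 0 < N) :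
    ∃ h₀ > 0, ∀ h, 0 < h → h < h₀ → ∀ f : En n, ‖f‖ = 1 →
      u z + ⟪p, (N * h) • f⟫ + h < u (z + (N * h) • f) → ⟪ν, f⟫ < 0 := by
  obtain ⟨ρ, hρ, hsub⟩ := Metric.isOpen_iff.1 hΩ z hz
  obtain ⟨ρ', hρ', hnear⟩ := exists_subgrad_near hΩ hu hz (ε := 1 / N) (by positivity)
  refine ⟨min ρ ρ' / N, div_pos (lt_min hρ hρ') hN, fun h hh hhlt f hf hlt => ?_⟩
  rw [lt_div_iff₀ hN, lt_min_iff] at hhlt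
  have hnorm : ‖(N * h) • f‖ = N * h := by
    rw [norm_smul, hf, mul_one, Real.norm_of_nonneg (by positivity)]
  have hmem : z + (N * h) • f ∈ Ω := hsub (by
    rw [Metric.mem_ball, dist_eq_norm, add_sub_cancel_left, hnorm]
    linarith [hhlt.1])
  obtain ⟨q, hq⟩ := subgrad_nonempty hΩ hu hmem
  obtain ⟨p', hp', hqp⟩ := hnear _ (by rw [add_sub_cancel_left, hnorm]; linarith [hhlt.2]) q hq
  obtain ⟨t, ht, rfl⟩ := hK p' hp'
  have h1 := hq z hz
  rw [sub_add_cancel_left, inner_neg_right, inner_smul_right] at h1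
  rw [inner_smul_right] at hlt
  have h2 : h < N * h * ⟪q - p, f⟫ := by
    rw [inner_sub_left]; linarith
  have h3 : 1 < N * ⟪q - p, f⟫ := by nlinarith
  have h4 : N * ⟪q - (p + t • ν), f⟫ < 1 := by
    have := real_inner_le_norm (q - (p + t • ν)) f
    rw [hf, mul_one] at this
    have h5 : ⟪q - (p + t • ν), f⟫ < 1 / N := lt_of_le_of_lt this hqp
    rw [lt_div_iff₀ hN] at h5
    linarith
  rw [← sub_sub, inner_sub_left, inner_smul_left, conj_trivial] at h4
  have h5 : 0 < N * (t * ⟪ν, f⟫) := by linarith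
  by_contra! h6
  nlinarith [mul_nonneg hN.le h6]

/-- If the subgradient at `z` lies on a ray ending at `p`, then the sections of `u` at `z` with
slope `p` have superlinear width in every direction. -/
lemma eventually_long_section (hΩ : IsOpen Ω) (hu : ConvexOn ℝ Ω u) {z p ν : En n} (hz : z ∈ Ω)
    (hK : ∀ p' ∈ subgrad Ω u z, ∃ t : ℝ, t ≤ 0 ∧ p' = p + t • ν) {N : ℝ} (hN : 0 < N) :
    ∃ h₀ > 0, ∀ h, 0 < h → h < h₀ → ∀ f : En n, ‖f‖ = 1 →
      ∃ s : ℝ, |s| = N * h ∧ u (z + s • f) ≤ u z + ⟪p, s • f⟫ + h := by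
  obtain ⟨h₀, hh₀, H⟩ := inner_neg_of_lt hΩ hu hz hK hN
  refine ⟨h₀, hh₀, fun h hh hlt f hf => ?_⟩
  by_contra! hcon
  have h1 := H h hh hlt f hf (hcon _ (abs_of_pos (by positivity)))
  have h2 := H h hh hlt (-f) (by rwa [norm_neg]) (by
    have := hcon (-(N * h)) (by rw [abs_neg, abs_of_pos (by positivity)])
    rwa [smul_neg, ← neg_smul])
  rw [inner_neg_right] at h2
  linarith

lemma exists_plane_lower_bound {p v₁ v₂ : En n} (hv₁ : v₁ ≠ 0) :
    ∃ c > 0, ∀ y ∈ Submodule.span ℝ {v₁, v₂}, ∃ q ∈ ({p, p + v₁, p + v₂} : Set (En n)),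
      c * ‖y‖ ≤ ⟪q - (p + (1 / 3 : ℝ) • (v₁ + v₂)), y⟫ := by
  set V := Submodule.span ℝ {v₁, v₂} with hV
  set pc := p + (1 / 3 : ℝ) • (v₁ + v₂) with hpc
  let φ : En n → ℝ := fun y => max ⟪p - pc, y⟫ (max ⟪p + v₁ - pc, y⟫ ⟪p + v₂ - pc, y⟫)
  have hφc : Continuous φ := by fun_prop
  have hS : IsCompact ((V : Set (En n)) ∩ Metric.sphere 0 1) :=
    (isCompact_sphere _ _).inter_left V.closed_of_finiteDimensional
  have hv₁V : v₁ ∈ V := Submodule.subset_span (by simp)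
  have hv₂V : v₂ ∈ V := Submodule.subset_span (by simp)
  obtain ⟨y₀, ⟨hy₀V, hy₀S⟩, hmin⟩ := hS.exists_isMinOn
    ⟨(‖v₁‖⁻¹ : ℝ) • v₁, V.smul_mem _ hv₁V, by
      simpa using norm_smul_inv_norm (𝕜 := ℝ) hv₁⟩ hφc.continuousOn
  have hy₀n : ‖y₀‖ = 1 := by simpa using hy₀S
  have hpos : 0 < φ y₀ := by
    by_contra! hle
    have h1 : ⟪p - pc, y₀⟫ ≤ 0 := (le_max_left _ _).trans hle
    have h2 : ⟪p + v₁ - pc, y₀⟫ ≤ 0 :=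
      (le_max_left _ _).trans ((le_max_right _ _).trans hle)
    have h3 : ⟪p + v₂ - pc, y₀⟫ ≤ 0 :=
      (le_max_right _ _).trans ((le_max_right _ _).trans hle)
    simp only [hpc, inner_sub_left, inner_add_left, inner_smul_left, conj_trivial] at h1 h2 h3
    have h4 : ⟪v₁, y₀⟫ = 0 := by linarith
    have h5 : ⟪v₂, y₀⟫ = 0 := by linarith
    have h6 : V ≤ (ℝ ∙ y₀)ᗮ := by
      rw [hV, Submodule.span_le]
      rintro w (rfl | rfl)
      · exact Submodule.mem_orthogonal_singleton_iff_inner_left.2 h4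
      · exact Submodule.mem_orthogonal_singleton_iff_inner_left.2 h5
    have h7 := Submodule.mem_orthogonal_singleton_iff_inner_left.1 (h6 hy₀V)
    rw [real_inner_self_eq_norm_sq, hy₀n] at h7
    norm_num at h7
  refine ⟨φ y₀, hpos, fun y hy => ?_⟩
  have key : φ y₀ * ‖y‖ ≤ φ y := by
    rcases eq_or_ne y 0 with rfl | hy0
    · simp [φ]
    · have hyn : 0 < ‖y‖ := norm_pos_iff.2 hy0
      have h1 : φ y₀ ≤ φ ((‖y‖⁻¹ : ℝ) • y) :=
        hmin ⟨V.smul_mem _ hy, by simpa using norm_smul_inv_norm (𝕜 := ℝ) hy0⟩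
      have h2 : φ ((‖y‖⁻¹ : ℝ) • y) = ‖y‖⁻¹ * φ y := by
        simp only [φ, inner_smul_right]
        rw [mul_max_of_nonneg _ _ (by positivity), mul_max_of_nonneg _ _ (by positivity)]
      rw [h2] at h1
      calc φ y₀ * ‖y‖ ≤ ‖y‖⁻¹ * φ y * ‖y‖ := by gcongr
        _ = φ y := by field_simp
  rcases le_max_iff.1 key with h | h
  · exact ⟨p, by simp, h⟩
  · rcases le_max_iff.1 h with h | h
    · exact ⟨p + v₁, by simp, h⟩
    · exact ⟨p + v₂, by simp, h⟩

lemma exists_orthonormalBasis_plane {v₁ v₂ : En n} (hv₁ : v₁ ≠ 0)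
    (hv₂ : v₂ ∉ Submodule.span ℝ {v₁}) :
    2 ≤ n ∧ ∃ f : OrthonormalBasis (Fin n) ℝ (En n),
      ∀ i : Fin n, (i : ℕ) < 2 → f i ∈ Submodule.span ℝ {v₁, v₂} := by
  set V := Submodule.span ℝ {v₁, v₂} with hV
  have hli : LinearIndependent ℝ ![v₁, v₂] := by
    rw [LinearIndependent.pair_iff' hv₁]
    intro a ha
    exact hv₂ (Submodule.mem_span_singleton.2 ⟨a, ha⟩)
  have hrank : Module.finrank ℝ V = 2 := by
    have := finrank_span_eq_card hli
    rwa [Matrix.range_cons_cons_empty, Fintype.card_fin] at this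
  have hn : 2 ≤ n := by
    have := Submodule.finrank_le V
    rwa [hrank, finrank_euclideanSpace_fin] at this
  refine ⟨hn, ?_⟩
  let w : OrthonormalBasis (Fin 2) ℝ V := (stdOrthonormalBasis ℝ V).reindex (finCongr hrank)
  let v : Fin n → En n := fun i => if hi : (i : ℕ) < 2 then (w ⟨i, hi⟩ : En n) else 0
  have hon : Orthonormal ℝ (({i : Fin n | (i : ℕ) < 2}).domRestrict v) := by
    have h1 : Orthonormal ℝ (fun i : Fin 2 => (w i : En n)) :=
      w.orthonormal.comp_linearIsometry V.subtypeₗᵢ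
    have h2 : ({i : Fin n | (i : ℕ) < 2}).domRestrict v =
        (fun i : Fin 2 => (w i : En n)) ∘
          fun i : {i : Fin n | (i : ℕ) < 2} => (⟨(i : Fin n), i.2⟩ : Fin 2) := by
      ext1 i
      have hi : ((i : Fin n) : ℕ) < 2 := i.2
      show v i = _
      simp only [v, hi, dif_pos, Function.comp_apply]
    rw [h2]
    refine h1.comp _ fun i j hij => ?_
    simpa [Subtype.ext_iff, Fin.ext_iff] using hij
  obtain ⟨f, hf⟩ := hon.exists_orthonormalBasis_extension_of_card_eq (by simp)
  refine ⟨f, fun i hi => ?_⟩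
  rw [hf i hi]
  simp only [v, hi, dif_pos]
  exact (w ⟨i, hi⟩).2

lemma volume_resolventImage_of_plane (hΩ : IsOpen Ω) (hu : ConvexOn ℝ Ω u) {x p v₁ v₂ : En n}
    (hx : x ∈ Ω) (hv₁ : v₁ ≠ 0) (hv₂ : v₂ ∉ Submodule.span ℝ {v₁}) (hp : p ∈ subgrad Ω u x)
    (hp₁ : p + v₁ ∈ subgrad Ω u x) (hp₂ : p + v₂ ∈ subgrad Ω u x) (L : ℝ) {r₀ : ℝ}
    (hr₀ : 0 < r₀) :
    ∃ r, 0 < r ∧ r < r₀ ∧ ENNReal.ofReal (L * r ^ (n - 1)) ≤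
      volume (resolventImage Ω u (Metric.closedBall x r)) := by
  obtain ⟨hn, f, hf⟩ := exists_orthonormalBasis_plane hv₁ hv₂
  obtain ⟨c, hc, hlow⟩ := exists_plane_lower_bound (p := p) (v₂ := v₂) hv₁
  set V := Submodule.span ℝ {v₁, v₂} with hV
  set pc := p + (1 / 3 : ℝ) • (v₁ + v₂) with hpc
  obtain ⟨ρ, hρ, hball⟩ := Metric.nhds_basis_closedBall.mem_iff.1 (hΩ.mem_nhds hx)
  set C : ℝ := (5 + 2 * n) ^ n with hC
  have hCpos : 0 < C := by positivity
  have hnpos : (0 : ℝ) < n := by exact_mod_cast (by omega : 0 < n)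
  set κ : ℝ := (2 * c / n) ^ 2 * 2 ^ (n - 2) with hκ
  have hκpos : 0 < κ := by positivity
  obtain ⟨a, ha, haρ, har, haL⟩ : ∃ a : ℝ, 0 < a ∧ 4 * a ≤ ρ ∧ 3 * a < r₀ ∧
      C * (|L| * 3 ^ (n - 1)) * a ≤ κ := by
    set D := C * (|L| * 3 ^ (n - 1)) with hD
    have hD0 : 0 ≤ D := by positivity
    refine ⟨min (ρ / 4) (min (r₀ / 4) (κ / (D + 1))), ?_, ?_, ?_, ?_⟩
    · have : 0 < κ / (D + 1) := by positivity
      exact lt_min (by linarith) (lt_min (by linarith) this)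
    · linarith [min_le_left (ρ / 4) (min (r₀ / 4) (κ / (D + 1)))]
    · have := (min_le_right (ρ / 4) (min (r₀ / 4) (κ / (D + 1)))).trans (min_le_left _ _)
      linarith
    · have := (min_le_right (ρ / 4) (min (r₀ / 4) (κ / (D + 1)))).trans (min_le_right _ _)
      calc D * _ ≤ D * (κ / (D + 1)) := by gcongr
        _ ≤ κ := by
          rw [mul_div_assoc', div_le_iff₀ (by positivity)]
          nlinarith
  let b : Fin n → En n := fun i => if (i : ℕ) < 2 then a • f i else f i
  have hb : |rowDet b| = a ^ 2 := by
    have h1 : rowDet b = a ^ 2 * rowDet f := by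
      have e0 : (⟨0, by omega⟩ : Fin n) ≠ ⟨1, by omega⟩ := by simp
      have : b = Function.update (Function.update (f : Fin n → En n) ⟨0, by omega⟩
          (a • f ⟨0, by omega⟩)) ⟨1, by omega⟩ (a • f ⟨1, by omega⟩) := by
        funext i
        by_cases h1 : i = ⟨1, by omega⟩
        · subst h1; simp [b]
        · rw [Function.update_of_ne h1]
          by_cases h0 : i = ⟨0, by omega⟩
          · subst h0; simp [b]
          · rw [Function.update_of_ne h0]
            have h0' : (i : ℕ) ≠ 0 := fun h => h0 (Fin.ext h)
            have h1' : (i : ℕ) ≠ 1 := fun h => h1 (Fin.ext h)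
            simp only [b]
            rw [if_neg (by omega)]
      rw [this, rowDet_update_smul, Function.update_comm e0, rowDet_update_smul,
        Function.update_eq_self, Function.update_eq_self]
      ring
    rw [h1, abs_mul, abs_rowDet_of_orthonormal f.orthonormal, mul_one, abs_of_pos (by positivity)]
  have hdet : rowDet b ≠ 0 := by
    rw [← abs_pos, hb]; positivity
  have hbge : ∀ i : Fin n, 2 ≤ (i : ℕ) → b i = f i := fun i hi => by
    simp only [b]; rw [if_neg (by omega)]
  have hmain := section_volume_le (p := pc) (h := c * a) hΩ hu (by positivity) ha haρ hball hdet hn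
    (fun i j hi hj => by
      rw [hbge i hi, hbge j hj]
      exact orthonormal_iff_ite.1 f.orthonormal i j)
    (by
      intro y hy hyρ hysec
      have hrepr : ∑ i, ⟪f i, y⟫ • f i = y := f.sum_repr' y
      have hyV : y ∈ V := by
        rw [← hrepr]
        refine V.sum_mem fun i _ => ?_
        by_cases hi : (i : ℕ) < 2
        · exact V.smul_mem _ (hf i hi)
        · rw [← hbge i (by omega), hy i (by omega), zero_smul]
          exact V.zero_mem
      obtain ⟨q, hq, hqy⟩ := hlow y hyV
      have hqsub : q ∈ subgrad Ω u x := by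
        rcases hq with rfl | rfl | rfl <;> assumption
      have h1 := hqsub (x + y) (hball (by simpa using hyρ))
      rw [add_sub_cancel_left] at h1
      rw [inner_sub_left] at hqy
      have hya : ‖y‖ ≤ a := by
        have : c * ‖y‖ ≤ c * a := by linarith
        exact le_of_mul_le_mul_left this hc
      refine ⟨hya, fun ξ hξ => ?_⟩
      have h2 : ⟪ξ, y⟫ = ∑ i, ⟪f i, y⟫ * ⟪f i, ξ⟫ := by
        conv_lhs => rw [← hrepr]
        rw [inner_sum]
        refine Finset.sum_congr rfl fun i _ => ?_
        rw [inner_smul_right, real_inner_comm ξ]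
      rw [h2]
      calc ∑ i, ⟪f i, y⟫ * ⟪f i, ξ⟫ ≤ ∑ _i : Fin n, a * (c / n) := by
            refine Finset.sum_le_sum fun i _ => ?_
            by_cases hi : (i : ℕ) < 2
            · have h3 := hξ i hi
              simp only [b, hi, if_true, inner_smul_left, conj_trivial, abs_mul] at h3
              rw [abs_of_pos ha] at h3
              have h4 : |⟪f i, ξ⟫| ≤ c / n := by
                have : a * |⟪f i, ξ⟫| ≤ a * (c / n) := h3.trans (le_of_eq (by ring))
                exact le_of_mul_le_mul_left this ha
              have h5 : |⟪f i, y⟫| ≤ a := by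
                have := abs_real_inner_le_norm (f i) y
                rw [f.norm_eq_one, one_mul] at this
                exact this.trans hya
              refine (le_abs_self _).trans ?_
              rw [abs_mul]
              exact mul_le_mul h5 h4 (abs_nonneg _) ha.le
            · rw [← hbge i (by omega), hy i (by omega), zero_mul]
              positivity
        _ = c * a := by
            rw [Finset.sum_const, Finset.card_univ, Fintype.card_fin, nsmul_eq_mul]
            field_simp)
  refine ⟨3 * a, by positivity, har, ?_⟩
  have h1 : ENNReal.ofReal C * ENNReal.ofReal (L * (3 * a) ^ (n - 1)) ≤
      ENNReal.ofReal C * volume (resolventImage Ω u (Metric.closedBall x (3 * a))) := by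
    refine le_trans ?_ hmain
    rw [← ENNReal.ofReal_mul hCpos.le, hb]
    refine ENNReal.ofReal_le_ofReal ?_
    have e : n - 1 = (n - 2) + 1 := by omega
    calc C * (L * (3 * a) ^ (n - 1)) ≤ C * (|L| * (3 * a) ^ (n - 1)) := by
          gcongr; exact le_abs_self L
      _ = C * (|L| * 3 ^ (n - 1)) * a * a ^ (n - 2) := by
          rw [mul_pow, e, pow_succ a]; ring
      _ ≤ κ * a ^ (n - 2) := by gcongr
      _ = (2 * (c * a) / n) ^ 2 * (2 * a) ^ (n - 2) / a ^ 2 := by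
          rw [hκ, mul_pow]
          field_simp
  rwa [ENNReal.mul_le_mul_iff_right (by simpa using hCpos) ENNReal.ofReal_ne_top] at h1

end Dichotomy

section MongeAmpere

variable {n : ℕ} {Ω : Set (En n)} {u η : En n → ℝ}

lemma rowDet_const_smul (a : ℝ) (b : Fin n → En n) :
    rowDet (fun i => a • b i) = a ^ n * rowDet b := by
  have h := Matrix.det_smul (Matrix.of fun i j => b i j) a
  rw [Fintype.card_fin] at h
  exact h

lemma box_mem_of_convex {T : Set (En n)} (hT : Convex ℝ T) {z e : En n} {τ τ' l : ℝ}
    (hτ : 0 ≤ τ) (hl : 0 < l) (hl1 : n * l ≤ 1 / 2) (hl2 : 2 * l * (1 + n * τ) ≤ τ')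
    (hseg : ∀ s ∈ Icc 0 τ', z + s • e ∈ T) {b : Fin n → En n}
    (hb : ∀ i : Fin n, (i : ℕ) + 1 < n → ∃ θ ∈ Icc 0 τ, z - θ • e + b i ∈ T)
    (hlast : ∀ j : Fin n, (j : ℕ) + 1 = n → b j = e) {c : En n} (hc : ∀ i, c i ∈ Icc (0 : ℝ) 1) :
    z + ∑ i, c i • (l • b i) ∈ T := by
  rcases Nat.eq_zero_or_pos n with hn | hn
  · subst hn
    simpa using hseg 0 ⟨le_rfl, by
      rw [Nat.cast_zero] at hl2
      linarith⟩
  set k : Fin n := ⟨n - 1, by omega⟩ with hk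
  have hbk : b k = e := hlast k (by simp [hk]; omega)
  set s := l * c k with hs
  have hs0 : 0 ≤ s := mul_nonneg hl.le (hc k).1
  have hsl : s ≤ l := mul_le_of_le_one_right hl.le (hc k).2
  have hn' : (0 : ℝ) < n := by exact_mod_cast hn
  let P : Fin n → En n := fun i =>
    z + s • e + (n : ℝ) • (if i = k then 0 else (c i * l) • b i)
  have hP : ∀ i, P i ∈ T := by
    intro i
    by_cases hik : i = k
    · simp only [P, hik, if_true, smul_zero, add_zero]
      refine hseg s ⟨hs0, hsl.trans ?_⟩
      have : 0 ≤ (n : ℝ) * τ := by positivity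
      nlinarith
    · obtain ⟨θ, ⟨hθ0, hθτ⟩, hθT⟩ := hb i (by
        have h1 : (i : ℕ) ≠ n - 1 := fun h => hik (Fin.ext h)
        have := i.2
        omega)
      set μ := n * (c i * l) with hμ
      have hμ0 : 0 ≤ μ := mul_nonneg hn'.le (mul_nonneg (hc i).1 hl.le)
      have hμn : μ ≤ n * l := by
        have : c i * l ≤ l := mul_le_of_le_one_left hl.le (hc i).2
        rw [hμ]; gcongr
      have hμ1 : 0 < 1 - μ := by linarith
      have h1 := hT (hseg ((s + μ * θ) / (1 - μ)) ⟨by positivity, by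
          rw [div_le_iff₀ hμ1]
          have h2 : μ * θ ≤ n * l * τ := mul_le_mul hμn hθτ hθ0 (by positivity)
          have h3 : 0 ≤ l * (1 + n * τ) := by positivity
          nlinarith⟩) hθT hμ1.le hμ0 (by ring)
      convert h1 using 1
      simp only [P, if_neg hik]
      have h2 : (1 - μ) * ((s + μ * θ) / (1 - μ)) = s + μ * θ := by field_simp
      rw [smul_add (1 - μ), smul_smul (1 - μ), h2, smul_smul, ← hμ]
      module
  have hsum := hT.sum_mem (t := Finset.univ) (w := fun _ => (1 / n : ℝ)) (z := P)
    (fun _ _ => by positivity) (by simp [hn'.ne']) (fun i _ => hP i)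
  convert hsum using 1
  have hPi : ∀ i, (1 / n : ℝ) • P i =
      (1 / n : ℝ) • (z + s • e) + (if i = k then 0 else (c i * l) • b i) := fun i => by
    simp only [P]
    rw [smul_add (1 / n : ℝ), smul_smul (1 / n : ℝ) (n : ℝ), one_div_mul_cancel hn'.ne', one_smul]
  simp only [hPi, Finset.sum_add_distrib, Finset.sum_const, Finset.card_univ, Fintype.card_fin]
  rw [← Nat.cast_smul_eq_nsmul ℝ, smul_smul, mul_one_div_cancel hn'.ne', one_smul, add_assoc]
  congr 1
  rw [← Finset.add_sum_erase _ _ (Finset.mem_univ k), ← Finset.add_sum_erase _ _ (Finset.mem_univ k),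
    hbk, if_pos rfl, zero_add, smul_smul, mul_comm (c k)]
  congr 1
  refine Finset.sum_congr rfl fun i hi => ?_
  rw [if_neg (Finset.ne_of_mem_erase hi), smul_smul]

lemma rowDet_sq_le (hMu : ∀ s : Set (En n), s ⊆ Ω → MeasurableSet s →
      (∫⁻ x in s, ENNReal.ofReal (η x)) ≤ MAm Ω u s)
    {z p : En n} (hp : p ∈ subgrad Ω u z) {h c₀ : ℝ} (hh : 0 < h) (hc₀ : 0 ≤ c₀)
    {b : Fin n → En n} (hbox : ∀ c : En n, (∀ i, c i ∈ Icc (0 : ℝ) 1) →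
      z + ∑ i, c i • b i ∈ Ω ∧ u (z + ∑ i, c i • b i) ≤ u z + ⟪p, ∑ i, c i • b i⟫ + h ∧
      c₀ ≤ η (z + ∑ i, c i • b i)) :
    c₀ * rowDet b ^ 2 ≤ (16 * h) ^ n := by
  by_cases hb : rowDet b = 0
  · have : (0 : ℝ) ≤ (16 * h) ^ n := by positivity
    simpa [hb] using this
  have hD : 0 < |rowDet b| := abs_pos.2 hb
  set A := parallelBox z b (fun _ => 1 / 4) (fun _ => 3 / 4) with hA
  have hAΩ : ∀ y ∈ A, y ∈ Ω ∧ c₀ ≤ η y := by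
    rintro y ⟨c, hc, rfl⟩
    have := hbox c fun i => ⟨by linarith [(hc i).1], by linarith [(hc i).2]⟩
    exact ⟨this.1, this.2.2⟩
  have hAm : MeasurableSet A := (isCompact_parallelBox _ _ _ _).measurableSet
  have hlow : ENNReal.ofReal (c₀ * (|rowDet b| * (1 / 2) ^ n)) ≤ MAm Ω u A := by
    refine le_trans ?_ (hMu A (fun y hy => (hAΩ y hy).1) hAm)
    calc ENNReal.ofReal (c₀ * (|rowDet b| * (1 / 2) ^ n)) = ENNReal.ofReal c₀ * volume A := by
          rw [hA, volume_parallelBox _ _ (fun _ => by norm_num), ← ENNReal.ofReal_mul hc₀]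
          congr 3
          rw [Finset.prod_const, Finset.card_univ, Fintype.card_fin]
          norm_num
      _ = ∫⁻ _ in A, ENNReal.ofReal c₀ := by rw [setLIntegral_const]
      _ ≤ _ := setLIntegral_mono' hAm fun y hy => ENNReal.ofReal_le_ofReal (hAΩ y hy).2
  have hup : MAm Ω u A ≤ ENNReal.ofReal ((8 * h) ^ n / |rowDet b|) := by
    have hsub : (⋃ x ∈ A, subgrad Ω u x) ⊆
        (fun q => -p + q) ⁻¹' {ξ : En n | ∀ i, |⟪b i, ξ⟫| ≤ 4 * h} := by
      refine iUnion₂_subset ?_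
      rintro y ⟨c, hc, rfl⟩ q hq i
      set y := z + ∑ i, c i • b i with hy
      have hmid := hp y (hbox c fun i => ⟨by linarith [(hc i).1], by linarith [(hc i).2]⟩).1
      have hstep : ∀ δ : ℝ, |δ| ≤ 1 / 4 → δ * ⟪b i, -p + q⟫ ≤ h := by
        intro δ hδ
        rw [abs_le] at hδ
        have h1 := hbox (c + WithLp.toLp 2 (Pi.single i δ)) (fun j => by
          have h2 := hc j
          by_cases hj : j = i
          · subst hj
            simp only [PiLp.add_apply, Pi.single_eq_same]
            exact ⟨by linarith [h2.1], by linarith [h2.2]⟩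
          · simp only [PiLp.add_apply, Pi.single_eq_of_ne hj, add_zero]
            exact ⟨by linarith [h2.1], by linarith [h2.2]⟩)
        have h2 : ∑ j, (c + WithLp.toLp 2 (Pi.single i δ) : En n) j • b j =
            ∑ j, c j • b j + δ • b i := by
          simp only [PiLp.add_apply, add_smul, Finset.sum_add_distrib]
          congr 1
          rw [Finset.sum_eq_single i]
          · simp
          · intro j _ hj
            simp [Pi.single_eq_of_ne hj]
          · simp
        rw [h2, ← add_assoc, ← hy, inner_add_right, inner_smul_right] at h1
        have h3 := hq _ h1.1
        rw [add_sub_cancel_left, inner_smul_right] at h3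
        rw [hy, add_sub_cancel_left, ← hy] at hmid
        rw [inner_add_right, inner_neg_right, real_inner_comm p, real_inner_comm q]
        linarith [h1.2.1]
      rw [abs_le]
      have h1 := hstep (1 / 4) (by norm_num [abs_le])
      have h2 := hstep (-(1 / 4)) (by norm_num [abs_le])
      constructor <;> linarith
    calc MAm Ω u A ≤ volume ((fun q => -p + q) ⁻¹' {ξ : En n | ∀ i, |⟪b i, ξ⟫| ≤ 4 * h}) :=
          measure_mono hsub
      _ = ENNReal.ofReal ((8 * h) ^ n / |rowDet b|) := by
          rw [measure_preimage_add, volume_dual_box hb (fun _ => by positivity),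
            Finset.prod_const, Finset.card_univ, Fintype.card_fin]
          congr 3
          ring
  have h1 := (ENNReal.ofReal_le_ofReal_iff (by positivity)).1 (hlow.trans hup)
  rw [le_div_iff₀ hD] at h1
  calc c₀ * rowDet b ^ 2 = c₀ * (|rowDet b| * (1 / 2) ^ n) * |rowDet b| * 2 ^ n := by
        rw [← sq_abs]
        have : (1 / 2 : ℝ) ^ n * 2 ^ n = 1 := by rw [← mul_pow]; norm_num
        linear_combination (-(c₀ * |rowDet b| ^ 2)) * this
    _ ≤ (8 * h) ^ n * 2 ^ n := by gcongr
    _ = (16 * h) ^ n := by rw [← mul_pow]; ring_nf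

end MongeAmpere

section FlatSegment

variable {n : ℕ} {Ω : Set (En n)} {u η : En n → ℝ}

lemma eq_affine_of_not_isStrictConvexPt (hΩ : IsOpen Ω) (hu : ConvexOn ℝ Ω u) {x x' : En n}
    (hx : x ∈ Ω) (hx' : x' ∈ Ω) (h : (u x' + u x) / 2 ≤ u ((1 / 2 : ℝ) • (x' + x))) {t : ℝ}
    (ht : t ∈ Icc (0 : ℝ) 1) :
    x + t • (x' - x) ∈ Ω ∧ u (x + t • (x' - x)) = u x + t * (u x' - u x) := by
  have he : x + t • (x' - x) = (1 - t) • x + t • x' := by module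
  have hmem : x + t • (x' - x) ∈ Ω := by
    rw [he]
    exact hu.1 hx hx' (by linarith [ht.2]) ht.1 (by ring)
  refine ⟨hmem, le_antisymm ?_ ?_⟩
  · rw [he]
    have := hu.2 hx hx' (by linarith [ht.2] : 0 ≤ 1 - t) ht.1 (by ring)
    simp only [smul_eq_mul] at this
    linarith
  · have hmid : (1 / 2 : ℝ) • (x' + x) ∈ Ω := by
      rw [smul_add]
      exact hu.1 hx' hx (by norm_num) (by norm_num) (by norm_num)
    obtain ⟨p, hp⟩ := subgrad_nonempty hΩ hu hmid
    have h1 := hp x hx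
    have h2 := hp x' hx'
    have h3 := hp _ hmem
    have e1 : x - (1 / 2 : ℝ) • (x' + x) = (-(1 / 2) : ℝ) • (x' - x) := by module
    have e2 : x' - (1 / 2 : ℝ) • (x' + x) = (1 / 2 : ℝ) • (x' - x) := by module
    have e3 : x + t • (x' - x) - (1 / 2 : ℝ) • (x' + x) = (t - 1 / 2) • (x' - x) := by module
    rw [e1, inner_smul_right] at h1
    rw [e2, inner_smul_right] at h2
    rw [e3, inner_smul_right] at h3
    nlinarith [ht.1, ht.2]

open Filter Topology in
/-- A point of `Σ_u \ L_η` is the endpoint of a segment along which `u` is affine and on whose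
interior `η` is somewhere positive. -/
lemma exists_flat_segment (hΩ : IsOpen Ω) (hu : ConvexOn ℝ Ω u) (hηc : ContinuousOn η Ω)
    (hηnn : ∀ x ∈ Ω, 0 ≤ η x) {x : En n} (hx : x ∈ SigmaSet Ω u \ Lset Ω η) :
    ∃ (z e : En n) (τ τ' : ℝ), ‖e‖ = 1 ∧ 0 < τ ∧ 0 < τ' ∧ x = z - τ • e ∧ 0 < η z ∧
      ∀ s ∈ Icc (-τ) τ', z + s • e ∈ Ω ∧
        ∀ p ∈ subgrad Ω u z, u (z + s • e) = u z + ⟪p, s • e⟫ := by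
  obtain ⟨⟨hxΩ, hnot⟩, hxL⟩ := hx
  unfold IsStrictConvexPt at hnot
  push Not at hnot
  obtain ⟨x', hx'Ω, hne, hle⟩ := hnot
  have haff := fun {t : ℝ} (ht : t ∈ Icc (0 : ℝ) 1) =>
    eq_affine_of_not_isStrictConvexPt hΩ hu hxΩ hx'Ω hle ht
  have hcont : ContinuousOn (fun t : ℝ => η (x + t • (x' - x))) (Icc 0 1) :=
    hηc.comp (by fun_prop) fun t ht => (haff ht).1
  have hpos : ∃ t₀ ∈ Icc (0 : ℝ) 1, 0 < η (x + t₀ • (x' - x)) := by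
    by_contra! hcon
    refine hxL ⟨x, x', hne.symm, ?_, left_mem_segment _ _ _⟩
    rw [segment_eq_image']
    rintro _ ⟨t, ht, rfl⟩
    exact ⟨(haff ht).1, le_antisymm (hcon t ht) (hηnn _ (haff ht).1)⟩
  obtain ⟨t₀, ht₀, hηt₀⟩ := hpos
  obtain ⟨t, ht, hηt⟩ : ∃ t ∈ Ioo (0 : ℝ) 1, 0 < η (x + t • (x' - x)) := by
    have h1 : ∀ᶠ t in 𝓝[Icc 0 1] t₀, 0 < η (x + t • (x' - x)) :=
      (hcont t₀ ht₀).eventually (lt_mem_nhds hηt₀)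
    have h2 : (𝓝[Ioo (0 : ℝ) 1] t₀).NeBot := by
      rw [← mem_closure_iff_nhdsWithin_neBot, closure_Ioo (by norm_num)]
      exact ht₀
    obtain ⟨t, h3, h4⟩ :=
      ((h1.filter_mono (nhdsWithin_mono _ Ioo_subset_Icc_self)).and self_mem_nhdsWithin).exists
    exact ⟨t, h4, h3⟩
  set d := x' - x with hd
  have hd0 : 0 < ‖d‖ := norm_pos_iff.2 (sub_ne_zero.2 hne)
  have hde : ‖d‖ • ((‖d‖⁻¹ : ℝ) • d) = d := by
    rw [smul_smul, mul_inv_cancel₀ hd0.ne', one_smul]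
  refine ⟨x + t • d, (‖d‖⁻¹ : ℝ) • d, t * ‖d‖, (1 - t) * ‖d‖,
    norm_smul_inv_norm (𝕜 := ℝ) (norm_pos_iff.1 hd0), mul_pos ht.1 hd0,
    mul_pos (by linarith [ht.2]) hd0, ?_, hηt, ?_⟩
  · rw [mul_smul, hde, add_sub_cancel_right]
  · intro s hs
    set r := s * ‖d‖⁻¹ with hr
    have hsr : s = r * ‖d‖ := by rw [hr]; field_simp
    have hr1 : -t ≤ r := by
      have h1 := hs.1
      rw [hsr, ← neg_mul] at h1
      exact le_of_mul_le_mul_right h1 hd0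
    have hr2 : r ≤ 1 - t := by
      have h1 := hs.2
      rw [hsr] at h1
      exact le_of_mul_le_mul_right h1 hd0
    have e1 : s • (‖d‖⁻¹ • d) = r • d := by rw [smul_smul]
    have e2 : x + t • d + r • d = x + (t + r) • d := by module
    have htr : t + r ∈ Icc (0 : ℝ) 1 := ⟨by linarith, by linarith⟩
    rw [e1, e2]
    refine ⟨(haff htr).1, fun p hp => ?_⟩
    have ht' : t ∈ Icc (0 : ℝ) 1 := Ioo_subset_Icc_self ht
    have h1 := hp x hxΩ
    have h2 := hp x' hx'Ω
    have e3 : x - (x + t • d) = (-t) • d := by module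
    have e4 : x' - (x + t • d) = (1 - t) • d := by rw [hd]; module
    rw [e3, inner_smul_right, (haff ht').2] at h1
    rw [e4, inner_smul_right, (haff ht').2] at h2
    have h3 : u x' - u x = ⟪p, d⟫ := by
      have h4 : t * ⟪p, d⟫ ≥ t * (u x' - u x) := by linarith
      have h5 : (1 - t) * ⟪p, d⟫ ≤ (1 - t) * (u x' - u x) := by linarith
      exact le_antisymm (le_of_mul_le_mul_left h4 ht.1)
        (le_of_mul_le_mul_left h5 (by linarith [ht.2]))
    rw [(haff htr).2, (haff ht').2, inner_smul_right, ← h3]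
    ring

end FlatSegment

section Density

open scoped Topology

variable {n : ℕ} {Ω : Set (En n)} {u η : En n → ℝ}

lemma exists_rowDet_lower_bound (hn : 0 < n) (hΩ : IsOpen Ω) (hu : ConvexOn ℝ Ω u) {x p : En n}
    {ρ L r₀ : ℝ} (hball : Metric.closedBall x ρ ⊆ Ω) (hL : 0 < L)
    (hsmall : ∀ r, 0 < r → r < r₀ → volume (resolventImage Ω u (Metric.closedBall x r)) ≤
      ENNReal.ofReal (L * r ^ (n - 1))) :
    ∃ c > 0, ∀ σ, 0 < σ → ∀ m : ℕ, 1 ≤ m → m < n → ∀ a, 0 < a → 4 * a ≤ ρ → 4 * a ≤ r₀ →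
      ∀ b : Fin n → En n, OrthonormalFrom m b → rowDet b ≠ 0 →
      (∀ y : En n, (∀ j : Fin n, m ≤ j → ⟪b j, y⟫ = 0) → ‖y‖ ≤ ρ →
        u (x + y) ≤ u x + ⟪p, y⟫ + σ ^ 2 → ‖y‖ ≤ a ∧
        ∀ ξ : En n, (∀ i : Fin n, i < m → |⟪b i, ξ⟫| ≤ σ ^ 2 / n) → ⟪ξ, y⟫ ≤ σ ^ 2) →
      c * σ ^ (2 * m) ≤ |rowDet b| * a ^ (m - 1) := by
  set C : ℝ := (5 + 2 * n) ^ n with hC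
  have hCpos : 0 < C := by positivity
  have hnpos : (0 : ℝ) < n := by exact_mod_cast hn
  have hn1 : (1 / n : ℝ) ≤ 1 := by
    rw [div_le_one hnpos]
    exact_mod_cast hn
  have hM : 0 < C * L * 3 ^ (n - 1) := by positivity
  refine ⟨(1 / n) ^ n / (C * L * 3 ^ (n - 1)), by positivity, ?_⟩
  intro σ hσ m hm1 hmn a ha haρ har b hb hdet hsec
  have hD : 0 < |rowDet b| := abs_pos.2 hdet
  have h1 := (section_volume_le (p := p) hΩ hu (pow_pos hσ 2) ha haρ hball hdet hmn.le hb hsec).trans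
    (mul_le_mul_right (hsmall (3 * a) (by positivity) (by linarith)) _)
  rw [← ENNReal.ofReal_mul hCpos.le, ENNReal.ofReal_le_ofReal_iff (by positivity),
    div_le_iff₀ hD] at h1
  have h2 : (1 / n : ℝ) ^ n * σ ^ (2 * m) * a ^ (n - m) ≤
      (2 * σ ^ 2 / n) ^ m * (2 * a) ^ (n - m) := by
    have h3 : (1 / n : ℝ) ^ n ≤ (1 / n : ℝ) ^ m :=
      pow_le_pow_of_le_one (by positivity) hn1 hmn.le
    calc (1 / n : ℝ) ^ n * σ ^ (2 * m) * a ^ (n - m)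
        ≤ (1 / n : ℝ) ^ m * σ ^ (2 * m) * a ^ (n - m) := by gcongr
      _ = (1 * σ ^ 2 / n) ^ m * (1 * a) ^ (n - m) := by
          rw [pow_mul, ← mul_pow]; congr 2 <;> ring
      _ ≤ _ := by gcongr <;> norm_num
  have h3 : (3 * a) ^ (n - 1) = 3 ^ (n - 1) * (a ^ (m - 1) * a ^ (n - m)) := by
    rw [mul_pow, ← pow_add]
    congr 2
    omega
  have h4 : (1 / n : ℝ) ^ n * σ ^ (2 * m) * a ^ (n - m) ≤
      C * L * 3 ^ (n - 1) * (|rowDet b| * a ^ (m - 1)) * a ^ (n - m) := by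
    refine (h2.trans h1).trans (le_of_eq ?_)
    rw [h3]; ring
  have h5 := le_of_mul_le_mul_right h4 (pow_pos ha _)
  rw [div_mul_eq_mul_div, div_le_iff₀ hM]
  linarith

lemma isCompact_section_union (hΩ : IsOpen Ω) (hu : ConvexOn ℝ Ω u) {x z p e : En n} {ρ h : ℝ}
    (hx : Metric.closedBall x ρ ⊆ Ω) (hz : Metric.closedBall z ρ ⊆ Ω) :
    IsCompact {y : En n | ⟪e, y⟫ = 0 ∧ ‖y‖ ≤ ρ ∧
      (u (x + y) ≤ u x + ⟪p, y⟫ + h ∨ u (z + y) ≤ u z + ⟪p, y⟫ + h)} := by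
  have hcl : ∀ w : En n, Metric.closedBall w ρ ⊆ Ω →
      IsClosed {y : En n | y ∈ Metric.closedBall 0 ρ ∧ u (w + y) ≤ u w + ⟪p, y⟫ + h} := by
    intro w hw
    refine Metric.isClosed_closedBall.isClosed_le ?_ (by fun_prop)
    exact (hu.continuousOn hΩ).comp (by fun_prop) fun y hy => hw (by simpa using hy)
  have he : IsClosed {y : En n | ⟪e, y⟫ = 0} := isClosed_eq (by fun_prop) continuous_const
  refine (congrArg IsCompact (Set.ext fun y => ?_)).mpr
    ((isCompact_closedBall (0 : En n) ρ).inter_right (he.inter ((hcl x hx).union (hcl z hz))))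
  simp only [mem_ofPred_eq, mem_inter_iff, mem_union, mem_closedBall_zero_iff]
  tauto

lemma eventually_lt_nhdsGT_zero {f : ℝ → ℝ} (hf : Continuous f) (h0 : f 0 = 0) {ε : ℝ}
    (hε : 0 < ε) : ∀ᶠ s in 𝓝[>] (0 : ℝ), f s < ε :=
  mem_nhdsWithin_of_mem_nhds ((hf.tendsto 0).eventually_lt_const (by rwa [h0]))

lemma eventually_exists_rowDet_of_small (hn : 0 < n) (hΩ : IsOpen Ω) (hu : ConvexOn ℝ Ω u)
    {x z p e ν : En n} {ρ L r₀ : ℝ} (hρ : 0 < ρ) (hr₀ : 0 < r₀) (hL : 0 < L)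
    (hx : Metric.closedBall x ρ ⊆ Ω) (hz : Metric.closedBall z ρ ⊆ Ω) (he : ‖e‖ = 1)
    (hK : ∀ p' ∈ subgrad Ω u z, ∃ t : ℝ, t ≤ 0 ∧ p' = p + t • ν)
    (hsmall : ∀ r, 0 < r → r < r₀ → volume (resolventImage Ω u (Metric.closedBall x r)) ≤
      ENNReal.ofReal (L * r ^ (n - 1))) (N : ℝ) :
    ∀ᶠ σ in 𝓝[>] (0 : ℝ), ∃ b : Fin n → En n, (∀ j : Fin n, (j : ℕ) + 1 = n → b j = e) ∧
      (∀ i : Fin n, (i : ℕ) + 1 < n → ‖b i‖ ≤ ρ ∧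
        (u (x + b i) ≤ u x + ⟪p, b i⟫ + σ ^ 2 ∨ u (z + b i) ≤ u z + ⟪p, b i⟫ + σ ^ 2)) ∧
      N * σ ^ n ≤ |rowDet b| := by
  obtain ⟨c, hc, hlow⟩ := exists_rowDet_lower_bound (p := p) hn hΩ hu hx hL hsmall
  have hpos : ∀ᶠ σ in 𝓝[>] (0 : ℝ), 0 < σ := eventually_mem_nhdsWithin
  have hsq : ∀ C : ℝ, ∀ ε > 0, ∀ᶠ σ in 𝓝[>] (0 : ℝ), C * σ ^ 2 < ε := fun C ε hε =>
    eventually_lt_nhdsGT_zero (f := fun σ => C * σ ^ 2) (by fun_prop) (by simp) hε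
  have main := eventually_exists_large_rowDet (e := e) (c := c) (ρ := min (ρ / 4) (r₀ / 4))
    (S := fun σ => {y : En n | ⟪e, y⟫ = 0 ∧ ‖y‖ ≤ ρ ∧
      (u (x + y) ≤ u x + ⟪p, y⟫ + σ ^ 2 ∨ u (z + y) ≤ u z + ⟪p, y⟫ + σ ^ 2)})
    hc (by positivity) (Filter.Eventually.of_forall fun σ => isCompact_section_union hΩ hu hx hz)
    (by
      intro N'
      obtain ⟨h₀, hh₀, H⟩ := eventually_long_section hΩ hu
        (hz (Metric.mem_closedBall_self hρ.le)) hK (N := max N' 1) (by positivity)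
      filter_upwards [hpos, hsq 1 h₀ hh₀, hsq (max N' 1) ρ hρ] with σ hσ h1 h2 f hf hef
      obtain ⟨s, hs, hus⟩ := H (σ ^ 2) (by positivity) (by linarith) f hf
      refine ⟨s, ?_, ?_, ?_, Or.inr hus⟩
      · rw [hs]
        gcongr
        exact le_max_left _ _
      · rw [inner_smul_right, hef, mul_zero]
      · rw [norm_smul, hf, mul_one, Real.norm_eq_abs, hs]
        exact h2.le)
    (by
      filter_upwards [hpos] with σ hσ m hm1 hmn a ha haρ b hb hbe hdet hS
      refine hlow σ hσ m hm1 hmn a ha (by linarith [min_le_left (ρ / 4) (r₀ / 4)])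
        (by linarith [min_le_right (ρ / 4) (r₀ / 4)]) b hb hdet fun y hy hyρ huy => ?_
      have hlast : b ⟨n - 1, by omega⟩ = e := hbe _ (by simp only; omega)
      refine hS y ⟨?_, hyρ, Or.inl huy⟩ hy
      rw [← hlast]
      exact hy _ (by simp only; omega))
    (n - 1) (by omega) N
  filter_upwards [main] with σ hσ
  obtain ⟨b, hbg, hbS, hdet⟩ := hσ (fun _ => e) (by
    intro i j hi hj
    have : i = j := Fin.ext (by omega)
    simp [this, he]) (fun _ _ => rfl)
  refine ⟨b, fun j hj => hbg j (by omega), fun i hi => (hbS i (by omega)).1.2, ?_⟩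
  rwa [Nat.sub_add_cancel hn] at hdet

lemma rowDet_sq_le_of_section (hu : ConvexOn ℝ Ω u)
    (hMu : ∀ s : Set (En n), s ⊆ Ω → MeasurableSet s →
      (∫⁻ x in s, ENNReal.ofReal (η x)) ≤ MAm Ω u s)
    {z e p : En n} {τ τ' l ρ c₀ h : ℝ} (hh : 0 < h) (hc₀ : 0 ≤ c₀) (hτ : 0 ≤ τ) (hτ' : 0 ≤ τ')
    (hl : 0 < l) (hl1 : n * l ≤ 1 / 2) (hl2 : 2 * l * (1 + n * τ) ≤ τ') (hlρ : n * l < ρ)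
    (he : ‖e‖ = 1) (hp : p ∈ subgrad Ω u z)
    (hseg : ∀ s ∈ Icc (-τ) τ', z + s • e ∈ Ω ∧ u (z + s • e) = u z + ⟪p, s • e⟫)
    (hη : ∀ y ∈ Metric.ball z ρ, c₀ ≤ η y) {b : Fin n → En n}
    (hlast : ∀ j : Fin n, (j : ℕ) + 1 = n → b j = e)
    (hb : ∀ i : Fin n, (i : ℕ) + 1 < n → ‖b i‖ ≤ 1 ∧ z - τ • e + b i ∈ Ω ∧ z + b i ∈ Ω ∧
      (u (z - τ • e + b i) ≤ u (z - τ • e) + ⟪p, b i⟫ + h ∨ u (z + b i) ≤ u z + ⟪p, b i⟫ + h)) :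
    c₀ * (l ^ n * rowDet b) ^ 2 ≤ (16 * h) ^ n := by
  rw [← rowDet_const_smul]
  refine rowDet_sq_le hMu hp hh hc₀ fun c hc => ?_
  have hT : Convex ℝ {y ∈ Ω | u y + -⟪p, y⟫ ≤ u z - ⟪p, z⟫ + h} := by
    refine (hu.add (g := fun y => -⟪p, y⟫) ?_).convex_le _
    exact ((-(innerₛₗ ℝ p)).convexOn hu.1)
  have hmem := box_mem_of_convex hT hτ hl hl1 hl2 (e := e) (z := z) (b := b) (c := c)
    (fun s hs => by
      obtain ⟨h1, h2⟩ := hseg s ⟨by linarith [hs.1], hs.2⟩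
      refine ⟨h1, ?_⟩
      rw [h2, inner_add_right]
      linarith)
    (fun i hi => by
      obtain ⟨-, h1, h2, h3 | h3⟩ := hb i hi
      · refine ⟨τ, ⟨hτ, le_rfl⟩, h1, ?_⟩
        have h4 := (hseg (-τ) ⟨le_rfl, by linarith⟩).2
        rw [neg_smul, ← sub_eq_add_neg, inner_neg_right] at h4
        rw [h4] at h3
        rw [inner_add_right, inner_sub_right]
        linarith
      · refine ⟨0, ⟨le_rfl, hτ⟩, ?_⟩
        rw [zero_smul, sub_zero]
        refine ⟨h2, ?_⟩
        rw [inner_add_right]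
        linarith)
    hlast hc
  refine ⟨hmem.1, ?_, hη _ ?_⟩
  · have h1 := hmem.2
    rw [inner_add_right] at h1
    linarith
  · rw [mem_ball_iff_norm, add_sub_cancel_left]
    refine lt_of_le_of_lt ?_ hlρ
    calc ‖∑ i, c i • (l • b i)‖ ≤ ∑ i : Fin n, l := by
          refine norm_sum_le_of_le _ fun i _ => ?_
          have hbi : ‖b i‖ ≤ 1 := by
            rcases Nat.lt_or_ge ((i : ℕ) + 1) n with hi | hi
            · exact (hb i hi).1
            · rw [hlast i (by omega), he]
          rw [norm_smul, norm_smul, Real.norm_of_nonneg (hc i).1, Real.norm_of_nonneg hl.le]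
          calc c i * (l * ‖b i‖) ≤ 1 * (l * 1) := by
                have := (hc i).1
                have := (hc i).2
                gcongr
            _ = l := by ring
      _ = n * l := by simp

lemma exists_large_resolventImage (hn : 0 < n) (hΩ : IsOpen Ω) (hu : ConvexOn ℝ Ω u)
    (hηc : ContinuousOn η Ω) (hηnn : ∀ x ∈ Ω, 0 ≤ η x)
    (hMu : ∀ s : Set (En n), s ⊆ Ω → MeasurableSet s →
      (∫⁻ x in s, ENNReal.ofReal (η x)) ≤ MAm Ω u s)
    {x : En n} (hx : x ∈ SigmaSet Ω u \ Lset Ω η) {L r₀ : ℝ} (hL : 0 < L) (hr₀ : 0 < r₀) :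
    ∃ r, 0 < r ∧ r < r₀ ∧ ENNReal.ofReal (L * r ^ (n - 1)) ≤
      volume (resolventImage Ω u (Metric.closedBall x r)) := by
  by_contra! hcon
  have hxΩ : x ∈ Ω := hx.1.1
  obtain ⟨z, e, τ, τ', he, hτ, hτ', hxz, hηz, hseg⟩ := exists_flat_segment hΩ hu hηc hηnn hx
  have hzΩ : z ∈ Ω := by simpa using (hseg 0 ⟨by linarith, hτ'.le⟩).1
  have hsub : subgrad Ω u z ⊆ subgrad Ω u x := by
    intro p hp y hy
    have h1 := (hseg (-τ) ⟨le_rfl, by linarith⟩).2 p hp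
    have h2 := hp y hy
    rw [neg_smul, ← sub_eq_add_neg, ← hxz, inner_neg_right] at h1
    rw [h1, hxz]
    simp only [inner_sub_right] at h2 ⊢
    linarith
  rcases exists_ray_or_plane (isCompact_subgrad hΩ hu hzΩ) (subgrad_nonempty hΩ hu hzΩ) with
    ⟨p, hp, ν, hK⟩ | ⟨p, v₁, v₂, hv₁, hv₂, hp, hp₁, hp₂⟩
  swap
  · obtain ⟨r, hr, hrr, h⟩ := volume_resolventImage_of_plane hΩ hu hxΩ hv₁ hv₂ (hsub hp)
      (hsub hp₁) (hsub hp₂) L hr₀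
    exact absurd h (not_le.2 (hcon r hr hrr))
  obtain ⟨ρx, hρx, hballx⟩ := Metric.nhds_basis_closedBall.mem_iff.1 (hΩ.mem_nhds hxΩ)
  obtain ⟨ρz, hρz, hballz⟩ := Metric.nhds_basis_closedBall.mem_iff.1 (hΩ.mem_nhds hzΩ)
  obtain ⟨ρ, hρ, hη⟩ : ∃ ρ > 0, ∀ y ∈ Metric.ball z ρ, η z / 2 ≤ η y := by
    have h1 := (hηc.continuousAt (hΩ.mem_nhds hzΩ)).eventually_const_lt
      (show η z / 2 < η z by linarith)
    obtain ⟨ρ, hρ, h⟩ := Metric.eventually_nhds_iff_ball.1 h1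
    exact ⟨ρ, hρ, fun y hy => (h y hy).le⟩
  set ρ₀ := min 1 (min ρx ρz) with hρ₀
  have hρ₀x : ρ₀ ≤ ρx := (min_le_right _ _).trans (min_le_left _ _)
  have hρ₀z : ρ₀ ≤ ρz := (min_le_right _ _).trans (min_le_right _ _)
  have hx₀ := (Metric.closedBall_subset_closedBall hρ₀x).trans hballx
  have hz₀ := (Metric.closedBall_subset_closedBall hρ₀z).trans hballz
  have hnpos : (0 : ℝ) < n := by exact_mod_cast hn
  obtain ⟨l, hl, hl1, hl2, hlρ⟩ : ∃ l : ℝ, 0 < l ∧ n * l ≤ 1 / 2 ∧ 2 * l * (1 + n * τ) ≤ τ' ∧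
      n * l < ρ := by
    have h1 := eventually_lt_nhdsGT_zero (f := fun l : ℝ => n * l) (by fun_prop) (by simp)
      (show (0 : ℝ) < 1 / 2 by norm_num)
    have h2 := eventually_lt_nhdsGT_zero (f := fun l : ℝ => 2 * l * (1 + n * τ)) (by fun_prop)
      (by simp) hτ'
    have h3 := eventually_lt_nhdsGT_zero (f := fun l : ℝ => n * l) (by fun_prop) (by simp) hρ
    have h4 : ∀ᶠ l in 𝓝[>] (0 : ℝ), 0 < l := eventually_mem_nhdsWithin
    obtain ⟨l, h1, h2, h3, h4⟩ := (h1.and (h2.and (h3.and h4))).exists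
    exact ⟨l, h4, h1.le, h2.le, h3⟩
  set κ := η z / 2 * (l ^ n) ^ 2 with hκ
  have hκpos : 0 < κ := by positivity
  set N := 16 ^ n / κ + 1 with hN
  have hN1 : 1 ≤ N := by
    have : 0 ≤ 16 ^ n / κ := by positivity
    linarith
  have hpos : ∀ᶠ σ in 𝓝[>] (0 : ℝ), 0 < σ := eventually_mem_nhdsWithin
  obtain ⟨σ, ⟨b, hlast, hb, hdet⟩, hσ⟩ := ((eventually_exists_rowDet_of_small hn hΩ hu
    (show 0 < ρ₀ by positivity) hr₀ hL hx₀ hz₀ he hK (fun r hr hrr => (hcon r hr hrr).le) N).and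
    hpos).exists
  have hmain := rowDet_sq_le_of_section hu hMu (h := σ ^ 2) (by positivity)
    (by positivity : 0 ≤ η z / 2) hτ.le hτ'.le hl hl1 hl2 hlρ he hp
    (fun s hs => ⟨(hseg s hs).1, (hseg s hs).2 p hp⟩) hη hlast (fun i hi => by
      obtain ⟨h1, h2⟩ := hb i hi
      rw [← hxz]
      exact ⟨h1.trans (min_le_left _ _), hx₀ (by simpa using h1), hz₀ (by simpa using h1), h2⟩)
  have h1 : (N * σ ^ n) ^ 2 ≤ rowDet b ^ 2 := by
    rw [← sq_abs (rowDet b)]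
    gcongr
  have h2 : κ * N ^ 2 * σ ^ (2 * n) ≤ 16 ^ n * σ ^ (2 * n) := by
    calc κ * N ^ 2 * σ ^ (2 * n) = κ * (N * σ ^ n) ^ 2 := by ring
      _ ≤ κ * rowDet b ^ 2 := by gcongr
      _ = η z / 2 * (l ^ n * rowDet b) ^ 2 := by rw [hκ]; ring
      _ ≤ (16 * σ ^ 2) ^ n := hmain
      _ = 16 ^ n * σ ^ (2 * n) := by rw [mul_pow, pow_mul]
  have h3 := le_of_mul_le_mul_right h2 (by positivity)
  have h4 : κ * N = 16 ^ n + κ := by rw [hN]; field_simp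
  nlinarith [mul_le_mul_of_nonneg_left hN1 (mul_pos hκpos (lt_of_lt_of_le one_pos hN1)).le]

end Density

section Covering

open scoped Topology

variable {n : ℕ} {Ω : Set (En n)} {u η : En n → ℝ}

lemma exists_countable_cover_of_density (hΩ : IsOpen Ω) (hu : ConvexOn ℝ Ω u) {E K : Set (En n)}
    (hKΩ : K ⊆ Ω) {L δ : ℝ}
    (hE : ∀ x ∈ E, ∃ r, 0 < r ∧ r < δ ∧ Metric.closedBall x r ⊆ K ∧
      ENNReal.ofReal (L * r ^ (n - 1)) ≤ volume (resolventImage Ω u (Metric.closedBall x r))) :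
    ∃ (F : Set (En n)) (r : En n → ℝ), F.Countable ∧ (∀ x ∈ F, 0 < r x ∧ r x < δ) ∧
      E ⊆ ⋃ x : F, Metric.closedBall (x : En n) (5 * r x) ∧
      ∑' x : F, ENNReal.ofReal (L * r x ^ (n - 1)) ≤ volume (resolventImage Ω u K) := by
  choose! r hr0 hrδ hrK hrv using hE
  obtain ⟨F, hFE, hFd, hF⟩ := Vitali.exists_disjoint_subfamily_covering_enlargement_closedBall
    E id r δ (fun a ha => (hrδ a ha).le) 5 (by norm_num)
  have hFc : F.Countable := hFd.countable_of_nonempty_interior fun x hx =>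
    ⟨x, Metric.ball_subset_interior_closedBall (Metric.mem_ball_self (hr0 x (hFE hx)))⟩
  refine ⟨F, r, hFc, fun x hx => ⟨hr0 x (hFE hx), hrδ x (hFE hx)⟩, fun x hx => ?_, ?_⟩
  · obtain ⟨y, hy, hxy⟩ := hF x hx
    exact mem_iUnion.2 ⟨⟨y, hy⟩, hxy (Metric.mem_closedBall_self (hr0 x hx).le)⟩
  · calc ∑' x : F, ENNReal.ofReal (L * r x ^ (n - 1))
        ≤ ∑' x : F, volume (resolventImage Ω u (Metric.closedBall (x : En n) (r x))) :=
          ENNReal.tsum_le_tsum fun x => hrv x (hFE x.2)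
      _ = volume (⋃ x ∈ F, resolventImage Ω u (Metric.closedBall x (r x))) := by
          rw [measure_biUnion hFc]
          · intro x hx y hy hxy
            exact disjoint_resolventImage ((hrK x (hFE hx)).trans hKΩ)
              ((hrK y (hFE hy)).trans hKΩ) (hFd hx hy hxy)
          · intro x hx
            exact (isCompact_resolventImage hΩ hu (isCompact_closedBall _ _)
              ((hrK x (hFE hx)).trans hKΩ)).measurableSet
      _ ≤ volume (resolventImage Ω u K) :=
          measure_mono (iUnion₂_subset fun x hx => resolventImage_mono (hrK x (hFE hx)))

lemma hausdorffMeasure_eq_zero_of_density (hn : 0 < n) (hΩ : IsOpen Ω) (hu : ConvexOn ℝ Ω u)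
    {E : Set (En n)} (hEΩ : E ⊆ Ω)
    (hE : ∀ x ∈ E, ∀ L r₀ : ℝ, 0 < L → 0 < r₀ → ∃ r, 0 < r ∧ r < r₀ ∧
      ENNReal.ofReal (L * r ^ (n - 1)) ≤ volume (resolventImage Ω u (Metric.closedBall x r))) :
    μH[(n : ℝ) - 1] E = 0 := by
  refine measure_null_of_locally_null E fun c hc => ?_
  obtain ⟨R, hR, hball⟩ := Metric.nhds_basis_closedBall.mem_iff.1 (hΩ.mem_nhds (hEΩ hc))
  refine ⟨E ∩ Metric.ball c (R / 2), inter_mem_nhdsWithin _ (Metric.ball_mem_nhds _ (half_pos hR)),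
    ?_⟩
  set M := volume (resolventImage Ω u (Metric.closedBall c R)) with hM
  have hMtop : M ≠ ⊤ :=
    (isCompact_resolventImage hΩ hu (isCompact_closedBall _ _) hball).measure_lt_top.ne
  have hcover := fun k : ℕ => exists_countable_cover_of_density (E := E ∩ Metric.ball c (R / 2))
    (L := (k : ℝ) + 1) (δ := 1 / ((k : ℝ) + 1)) hΩ hu hball (by
      intro x hx
      obtain ⟨r, hr0, hr, hv⟩ := hE x hx.1 (k + 1) (min (1 / ((k : ℝ) + 1)) (R / 2))
        (by positivity) (by positivity)
      refine ⟨r, hr0, hr.trans_le (min_le_left _ _), ?_, hv⟩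
      have h1 := hr.trans_le (min_le_right _ _)
      have h2 := Metric.mem_ball.1 hx.2
      exact Metric.closedBall_subset_closedBall' (by linarith))
  choose F r hFc hr hsub hsum using hcover
  have hcount : ∀ k, Countable (F k) := fun k => (hFc k).to_subtype
  have hdiam : ∀ k, ∀ x : F k, Metric.ediam (Metric.closedBall (x : En n) (5 * r k x)) ≤
      ENNReal.ofReal (10 * r k x) := by
    intro k x
    rw [← Metric.closedEBall_ofReal (by linarith [(hr k x x.2).1])]
    refine Metric.ediam_closedEBall_le.trans (le_of_eq ?_)
    rw [← ENNReal.ofReal_ofNat 2, ← ENNReal.ofReal_mul (by norm_num)]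
    congr 1
    ring
  have hlim : Filter.Tendsto (fun k : ℕ => 10 * (1 / ((k : ℝ) + 1))) Filter.atTop (𝓝 0) := by
    simpa using tendsto_one_div_add_atTop_nhds_zero_nat.const_mul (10 : ℝ)
  have hle := Measure.hausdorffMeasure_le_liminf_tsum ((n : ℝ) - 1) (E ∩ Metric.ball c (R / 2))
    (l := Filter.atTop) (fun k : ℕ => ENNReal.ofReal (10 * (1 / ((k : ℝ) + 1))))
    (by simpa using ENNReal.tendsto_ofReal hlim)
    (fun k (x : F k) => Metric.closedBall (x : En n) (5 * r k x))
    (Filter.Eventually.of_forall fun k x => (hdiam k x).trans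
      (ENNReal.ofReal_le_ofReal (by linarith [(hr k x x.2).2])))
    (Filter.Eventually.of_forall hsub)
  refine le_antisymm (hle.trans ?_) bot_le
  have hbound : ∀ k : ℕ, ∑' x : F k, Metric.ediam (Metric.closedBall (x : En n) (5 * r k x)) ^
      ((n : ℝ) - 1) ≤ ENNReal.ofReal (10 ^ (n - 1) * (1 / ((k : ℝ) + 1))) * M := by
    intro k
    refine le_trans ?_ (mul_le_mul_right (hsum k) _)
    rw [← ENNReal.tsum_mul_left]
    refine ENNReal.tsum_le_tsum fun x => ?_
    have hrx := (hr k x x.2).1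
    have hcast : (n : ℝ) - 1 = ((n - 1 : ℕ) : ℝ) := by
      rw [Nat.cast_sub hn, Nat.cast_one]
    rw [hcast, ENNReal.rpow_natCast, ← ENNReal.ofReal_mul (by positivity)]
    refine (pow_le_pow_left' (hdiam k x) _).trans ?_
    rw [← ENNReal.ofReal_pow (by positivity)]
    refine ENNReal.ofReal_le_ofReal (le_of_eq ?_)
    rw [mul_pow]
    field_simp
  have hlim' : Filter.Tendsto (fun k : ℕ => ENNReal.ofReal (10 ^ (n - 1) * (1 / ((k : ℝ) + 1))) * M)
      Filter.atTop (𝓝 0) := by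
    have h1 := ENNReal.tendsto_ofReal
      (tendsto_one_div_add_atTop_nhds_zero_nat.const_mul ((10 : ℝ) ^ (n - 1)))
    rw [mul_zero, ENNReal.ofReal_zero] at h1
    simpa using ENNReal.Tendsto.mul_const h1 (Or.inr hMtop)
  exact (Filter.liminf_le_liminf (Filter.Eventually.of_forall hbound)).trans hlim'.liminf_eq.le

end Covering

/-- Theorem 1.9 (first part of Theorem `thm:hausdorff n-1`):
`H^{n-1}(Σ_u \ L_η) = 0` for convex solutions of `det D²u ≥ η`. -/
theorem statement_6 {n : ℕ} (Ω : Set (En n)) (hΩo : IsOpen Ω)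
    (η : En n → ℝ) (hηc : ContinuousOn η Ω) (hηnn : ∀ x ∈ Ω, 0 ≤ η x)
    (u : En n → ℝ) (hu : ConvexOn ℝ Ω u)
    (hMu : ∀ s : Set (En n), s ⊆ Ω → MeasurableSet s →
      (∫⁻ x in s, ENNReal.ofReal (η x)) ≤ MAm Ω u s) :
    μH[(n : ℝ) - 1] (SigmaSet Ω u \ Lset Ω η) = 0 := by
  rcases Nat.eq_zero_or_pos n with rfl | hn
  · have h : SigmaSet Ω u \ Lset Ω η = ∅ := eq_empty_of_forall_notMem fun x hx =>
      hx.1.2 fun y _ hy => absurd (Subsingleton.elim y x) hy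
    rw [h, measure_empty]
  · exact hausdorffMeasure_eq_zero_of_density hn hΩo hu (fun x hx => hx.1.1)
      fun x hx L r₀ hL hr₀ =>
        exists_large_resolventImage hn hΩo hu hηc hηnn hMu hx hL hr₀
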